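/- arXiv:1112.1923 — 3 statements merged into one kernel-verified Lean document; each statement's English description precedes it below -/
import Mathlib

section
/- For all integers n ≥ 4, the induced saturation number of the path on four vertices satisfies indsat(n, P_4) = ⌈(n+1)/3⌉. -/
open SimpleGraph

/-- A trigraph: the pairs of distinct vertices are partitioned into black edges,
gray edges, and (implicitly) white edges. -/
structure Trigraph (V : Type*) where
  /-- the graph of black edges -/
  black : SimpleGraph V
  /-- the graph of gray edges -/
  gray : SimpleGraph V
  /-- no pair is simultaneously black and gray -/
  disjoint : ∀ u v : V, ¬ (black.Adj u v ∧ gray.Adj u v)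

namespace Trigraph

variable {V : Type*} {W : Type*}

/-- `u v` is a white edge of `T`: the vertices are distinct and joined by neither a
black edge nor a gray edge. -/
def White (T : Trigraph V) (u v : V) : Prop :=
  u ≠ v ∧ ¬ T.black.Adj u v ∧ ¬ T.gray.Adj u v

/-- A realization of a trigraph is a graph containing every black edge and contained
in the union of the black and gray edges. -/
def IsRealization (T : Trigraph V) (R : SimpleGraph V) : Prop :=
  T.black ≤ R ∧ R ≤ T.black ⊔ T.gray

/-- The graph with the single edge `uv` (empty if `u = v`). -/
def single (u v : V) : SimpleGraph V := SimpleGraph.fromEdgeSet {s(u, v)}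

/-- The trigraph obtained from `T` by recoloring the pair `uv` gray. -/
def flip (T : Trigraph V) (u v : V) : Trigraph V where
  black := T.black \ single u v
  gray := T.gray ⊔ single u v
  disjoint := by
    intro a b h
    have := T.disjoint a b
    simp only [SimpleGraph.sdiff_adj, SimpleGraph.sup_adj] at h
    tauto

/-- `G` contains an induced copy of `H`. -/
def HasInducedCopy (H : SimpleGraph W) (G : SimpleGraph V) : Prop :=
  Nonempty (H ↪g G)

/-- A trigraph `T` is `H`-induced-saturated if no realization of `T` contains an
induced copy of `H`, but whenever any black or white edge of `T` is recolored gray,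
some realization of the resulting trigraph contains an induced copy of `H`. -/
def IsIndSat (H : SimpleGraph W) (T : Trigraph V) : Prop :=
  (∀ R : SimpleGraph V, T.IsRealization R → ¬ HasInducedCopy H R) ∧
  (∀ u v : V, u ≠ v → ¬ T.gray.Adj u v →
    ∃ R : SimpleGraph V, (T.flip u v).IsRealization R ∧ HasInducedCopy H R)

/-- The induced saturation number: the least number of gray edges in an
`H`-induced-saturated trigraph on `n` vertices (`⊤` if none exists). -/
noncomputable def indsat (n : ℕ) (H : SimpleGraph W) : ℕ∞ :=
  sInf {k : ℕ∞ | ∃ T : Trigraph (Fin n), IsIndSat H T ∧ (T.gray.edgeSet.ncard : ℕ∞) = k}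

/-- `G` contains a (not necessarily induced) copy of `H` as a subgraph. -/
def HasSubCopy (H : SimpleGraph W) (G : SimpleGraph V) : Prop :=
  ∃ f : W → V, Function.Injective f ∧ ∀ a b : W, H.Adj a b → G.Adj (f a) (f b)

/-- A graph `G` is `H`-saturated if it contains no copy of `H` but adding any new
edge creates a copy of `H`. -/
def IsSat (H : SimpleGraph W) (G : SimpleGraph V) : Prop :=
  ¬ HasSubCopy H G ∧
  ∀ u v : V, u ≠ v → ¬ G.Adj u v → HasSubCopy H (G ⊔ single u v)

/-- The saturation number: the least number of edges of an `H`-saturated graph on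
`n` vertices (`⊤` if none exists). -/
noncomputable def satNum (n : ℕ) (H : SimpleGraph W) : ℕ∞ :=
  sInf {k : ℕ∞ | ∃ G : SimpleGraph (Fin n), IsSat H G ∧ (G.edgeSet.ncard : ℕ∞) = k}

/-- The subtrigraph induced on a set of vertices. -/
def induce (s : Set V) (T : Trigraph V) : Trigraph s where
  black := T.black.induce s
  gray := T.gray.induce s
  disjoint := by
    intro a b h
    exact T.disjoint a b (by simpa using h)

/-- The complement trigraph: black and white edges are exchanged, gray edges are
unchanged. -/
def compl (T : Trigraph V) : Trigraph V where
  black := (T.black ⊔ T.gray)ᶜ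
  gray := T.gray
  disjoint := by
    intro a b h
    rcases h with ⟨hb, hg⟩
    rw [SimpleGraph.compl_adj] at hb
    exact hb.2 ((SimpleGraph.sup_adj _ _ _ _).mpr (Or.inr hg))

end Trigraph

namespace IndSatP4

def PP {V : Type*} (E N : V → V → Prop) (a b c d : V) : Prop :=
  E a b ∧ E b c ∧ E c d ∧ N a c ∧ N b d ∧ N a d

def Fl {V : Type*} (R : V → V → Prop) (u v x y : V) : Prop :=
  R x y ∨ (x = u ∧ y = v) ∨ (x = v ∧ y = u)

structure TG {V : Type*} (E N : V → V → Prop) : Prop where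
  symE : ∀ x y, E x y → E y x
  symN : ∀ x y, N x y → N y x
  irE : ∀ x, ¬ E x x
  irN : ∀ x, ¬ N x x
  tot : ∀ x y, x ≠ y → E x y ∨ N x y
  noP : ∀ a b c d, ¬ PP E N a b c d

def Sat {V : Type*} (E N : V → V → Prop) (S : Finset V) : Prop :=
  ∀ u ∈ S, ∀ v ∈ S, u ≠ v → ¬ (E u v ∧ N u v) →
    ∃ a ∈ S, ∃ b ∈ S, ∃ c ∈ S, ∃ d ∈ S, PP (Fl E u v) (Fl N u v) a b c d

open Classical in
noncomputable def gg {V : Type*} (E N : V → V → Prop) (S : Finset V) : ℕ :=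
  ((S ×ˢ S).filter (fun p => E p.1 p.2 ∧ N p.1 p.2)).card

def Univ {V : Type*} (E : V → V → Prop) (S : Finset V) (v : V) : Prop :=
  ∀ x ∈ S, x ≠ v → ¬ E v x

variable {V : Type*} {E N : V → V → Prop}

theorem TG.swap (h : TG E N) : TG N E := by
  obtain ⟨h1, h2, h3, h4, h5, h6⟩ := h
  refine ⟨h2, h1, h4, h3, fun x y hxy => (h5 x y hxy).symm, fun a b c d hp => ?_⟩
  obtain ⟨p1, p2, p3, p4, p5, p6⟩ := hp
  exact h6 b d a c ⟨p5, h1 _ _ p6, p4, h2 _ _ p1, h2 _ _ p3, p2⟩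

theorem Fl.symm {u v x y : V} (h : ∀ x y, E x y → E y x) (hf : Fl E u v x y) : Fl E u v y x := by
  unfold Fl at *; grind

theorem Sat.swap (h : TG E N) {S : Finset V} (hs : Sat E N S) : Sat N E S := by
  intro u hu v hv huv hg
  obtain ⟨a, ha, b, hb, c, hc, d, hd, p1, p2, p3, p4, p5, p6⟩ := hs u hu v hv huv (fun h => hg h.symm)
  exact ⟨b, hb, d, hd, a, ha, c, hc, p5, Fl.symm h.symN p6, p4, Fl.symm h.symE p1,
    Fl.symm h.symE p3, p2⟩

theorem gg_swap (S : Finset V) : gg N E S = gg E N S := by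
  unfold gg; congr 1; ext p; simp [and_comm]

theorem Sat.four (h : TG E N) {S : Finset V} (hs : Sat E N S) {u v : V} (hu : u ∈ S) (hv : v ∈ S)
    (huv : u ≠ v) (hg : ¬ (E u v ∧ N u v)) : 4 ≤ S.card := by
  classical
  obtain ⟨a, ha, b, hb, c, hc, d, hd, p1, p2, p3, p4, p5, p6⟩ := hs u hu v hv huv hg
  have h1 := h.irE
  have h2 := h.irN
  unfold Fl at *
  have : ({a, b, c, d} : Finset V).card = 4 := by
    rw [Finset.card_eq_of_equiv_fin]
    have e1 : a ≠ b := by grind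
    have e2 : a ≠ c := by grind
    have e3 : a ≠ d := by grind
    have e4 : b ≠ c := by grind
    have e5 : b ≠ d := by grind
    have e6 : c ≠ d := by grind
    exact (Finset.equivFinOfCardEq (by
      rw [Finset.card_insert_of_notMem (by simp [*]), Finset.card_insert_of_notMem (by simp [*]),
        Finset.card_insert_of_notMem (by simp [*])]; simp))
  rw [← this]
  apply Finset.card_le_card
  intro x; simp; rintro (rfl | rfl | rfl | rfl) <;> assumption

theorem Sat.hom (h : TG E N) {S M : Finset V} (hs : Sat E N S) (hM : M ⊆ S)
    (hh : ∀ z ∈ S, z ∉ M → (∀ y ∈ M, ¬ E z y) ∨ (∀ y ∈ M, ¬ N z y)) : Sat E N M := by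
  intro u hu v hv huv hg
  obtain ⟨a, ha, b, hb, c, hc, d, hd, hp⟩ := hs u (hM hu) v (hM hv) huv hg
  have hF : ∀ R : V → V → Prop, ∀ x y, (x ∉ M ∨ y ∉ M) → Fl R u v x y → R x y := by
    intro R x y; unfold Fl; grind
  have hA : ∀ z ∈ S, z ∉ M → ∀ x ∈ M, ∀ y ∈ M, Fl E u v z x → Fl N u v z y → False := by
    intro z hz hzM x hx y hy e n
    have := hF E z x (Or.inl hzM) e
    have := hF N z y (Or.inl hzM) n
    rcases hh z hz hzM with h | h
    · exact h x hx ‹_›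
    · exact h y hy ‹_›
  have sE : ∀ x y, Fl E u v x y → Fl E u v y x := fun x y => Fl.symm h.symE
  have sN : ∀ x y, Fl N u v x y → Fl N u v y x := fun x y => Fl.symm h.symN
  have hnp := h.noP a b c d
  obtain ⟨p1, p2, p3, p4, p5, p6⟩ := hp
  have q1 := sE _ _ p1
  have q2 := sE _ _ p2
  have q3 := sE _ _ p3
  have q4 := sN _ _ p4
  have q5 := sN _ _ p5
  have q6 := sN _ _ p6
  have a1 : a ∉ M → b ∈ M → c ∈ M → False := fun m x y => hA a ha m b x c y p1 p4
  have a2 : a ∉ M → b ∈ M → d ∈ M → False := fun m x y => hA a ha m b x d y p1 p6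
  have b1 : b ∉ M → a ∈ M → d ∈ M → False := fun m x y => hA b hb m a x d y q1 p5
  have b2 : b ∉ M → c ∈ M → d ∈ M → False := fun m x y => hA b hb m c x d y p2 p5
  have c1 : c ∉ M → b ∈ M → a ∈ M → False := fun m x y => hA c hc m b x a y q2 q4
  have c2 : c ∉ M → d ∈ M → a ∈ M → False := fun m x y => hA c hc m d x a y p3 q4
  have d1 : d ∉ M → c ∈ M → b ∈ M → False := fun m x y => hA d hd m c x b y q3 q5
  have d2 : d ∉ M → c ∈ M → a ∈ M → False := fun m x y => hA d hd m c x a y q3 q6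
  have e1 : ¬ ((a ∉ M ∨ b ∉ M) ∧ (b ∉ M ∨ c ∉ M) ∧ (c ∉ M ∨ d ∉ M) ∧ (a ∉ M ∨ c ∉ M) ∧
      (b ∉ M ∨ d ∉ M) ∧ (a ∉ M ∨ d ∉ M)) := fun ⟨e1, e2, e3, e4, e5, e6⟩ =>
    hnp ⟨hF _ _ _ e1 p1, hF _ _ _ e2 p2, hF _ _ _ e3 p3, hF _ _ _ e4 p4, hF _ _ _ e5 p5,
      hF _ _ _ e6 p6⟩
  have key : a ∈ M ∧ b ∈ M ∧ c ∈ M ∧ d ∈ M := by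
    clear hF hA sE sN hnp
    grind
  exact ⟨a, key.1, b, key.2.1, c, key.2.2.1, d, key.2.2.2, p1, p2, p3, p4, p5, p6⟩

theorem gg_mono {S M : Finset V} (hM : M ⊆ S) : gg E N M ≤ gg E N S := by
  classical
  unfold gg
  exact Finset.card_le_card (Finset.filter_subset_filter _ (Finset.product_subset_product hM hM))

theorem gg_add {S X Y : Finset V} (hX : X ⊆ S) (hY : Y ⊆ S) (hd : Disjoint X Y) :
    gg E N X + gg E N Y ≤ gg E N S := by
  classical
  unfold gg
  rw [← Finset.card_union_of_disjoint]
  · apply Finset.card_le_card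
    intro p hp
    simp only [Finset.mem_union, Finset.mem_filter, Finset.mem_product] at hp ⊢
    have := @hX p.1
    have := @hX p.2
    have := @hY p.1
    have := @hY p.2
    tauto
  · rw [Finset.disjoint_left] at hd ⊢
    intro p hp
    simp only [Finset.mem_filter, Finset.mem_product] at hp ⊢
    have := @hd p.1
    tauto

/-- Seinsche -/
theorem seinsche (k : ℕ) : ∀ (R Q : V → V → Prop), TG R Q → (∀ x y, ¬ (R x y ∧ Q x y)) →
    ∀ S : Finset V, S.card = k → 2 ≤ k →
    ∃ X Y : Finset V, X.Nonempty ∧ Y.Nonempty ∧ Disjoint X Y ∧ (∀ x, x ∈ S ↔ x ∈ X ∨ x ∈ Y) ∧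
      ((∀ x ∈ X, ∀ y ∈ Y, ¬ R x y) ∨ (∀ x ∈ X, ∀ y ∈ Y, ¬ Q x y)) := by
  classical
  -- the one-sided step
  have step : ∀ (R Q : V → V → Prop), TG R Q → (∀ x y, ¬ (R x y ∧ Q x y)) →
    ∀ S : Finset V, ∀ v ∈ S, ∀ X Y : Finset V, X.Nonempty → Y.Nonempty → Disjoint X Y →
    (∀ x, x ∈ S.erase v ↔ x ∈ X ∨ x ∈ Y) → (∀ x ∈ X, ∀ y ∈ Y, ¬ R x y) → 
    ∃ X Y : Finset V, X.Nonempty ∧ Y.Nonempty ∧ Disjoint X Y ∧ (∀ x, x ∈ S ↔ x ∈ X ∨ x ∈ Y) ∧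
      ((∀ x ∈ X, ∀ y ∈ Y, ¬ R x y) ∨ (∀ x ∈ X, ∀ y ∈ Y, ¬ Q x y)) := by
    intro R Q h hx S v hv X Y hX hY hd hS hXY
    have sR := h.symE
    have sQ := h.symN
    have tot := h.tot
    have noP := h.noP
    unfold PP at noP
    rw [Finset.disjoint_left] at hd
    simp only [Finset.mem_erase] at hS
    by_cases c1 : ∀ x ∈ X, ¬ R v x
    · refine ⟨X, insert v Y, hX, by simp, ?_, ?_, Or.inl ?_⟩
      · rw [Finset.disjoint_left]; grind
      · grind
      · grind
    by_cases c2 : ∀ x ∈ Y, ¬ R v x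
    · refine ⟨Y, insert v X, hY, by simp, ?_, ?_, Or.inl ?_⟩
      · rw [Finset.disjoint_left]; grind
      · grind
      · grind
    push Not at c1 c2
    obtain ⟨x0, hx0, hvx0⟩ := c1
    obtain ⟨y0, hy0, hvy0⟩ := c2
    by_cases c3 : ∀ x ∈ S.erase v, R v x
    · refine ⟨{v}, S.erase v, by simp, ⟨x0, by grind⟩, by simp, by grind, Or.inr ?_⟩
      grind
    push Not at c3
    obtain ⟨w, hw, hvw⟩ := c3
    refine ⟨(S.erase v).filter (fun x => ¬ R v x), insert v ((S.erase v).filter (fun x => R v x)),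
      ⟨w, by grind⟩, by simp, ?_, by grind, Or.inl ?_⟩
    · rw [Finset.disjoint_left]; grind
    · intro a' ha' a ha hr
      simp only [Finset.mem_insert, Finset.mem_filter, Finset.mem_erase] at ha' ha
      rcases ha with rfl | ⟨⟨hav, haS⟩, hva⟩
      · grind
      · obtain ⟨⟨ha'v, ha'S⟩, hva'⟩ := ha'
        have m1 := (hS a).1 ⟨hav, haS⟩
        have m2 := (hS a').1 ⟨ha'v, ha'S⟩
        have q1 : Q a' v := sQ _ _ ((tot v a' (Ne.symm ha'v)).resolve_left hva')
        rcases m1 with m1 | m1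
        · have m2 : a' ∈ X := by grind
          have q2 : Q a y0 := (tot a y0 (by grind)).resolve_left (by grind)
          have q3 : Q a' y0 := (tot a' y0 (by grind)).resolve_left (by grind)
          exact noP a' a v y0 ⟨hr, sR _ _ hva, hvy0, q1, q2, q3⟩
        · have m2 : a' ∈ Y := by grind
          have q2 : Q a x0 := (tot a x0 (by grind)).resolve_left (by grind)
          have q3 : Q a' x0 := (tot a' x0 (by grind)).resolve_left (by grind)
          exact noP a' a v x0 ⟨hr, sR _ _ hva, hvx0, q1, q2, q3⟩
  induction k with
  | zero => intros; omega
  | succ k ih =>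
    intro R Q h hx S hS hk
    obtain ⟨v, hv⟩ : S.Nonempty := by rw [← Finset.card_pos]; omega
    have hc : (S.erase v).card = k := by rw [Finset.card_erase_of_mem hv]; omega
    by_cases hk2 : k = 1
    · obtain ⟨w, hw⟩ := Finset.card_eq_one.1 (hc.trans hk2)
      have hwv : w ≠ v := by
        have : w ∈ S.erase v := by simp [hw]
        exact (Finset.mem_erase.1 this).1
      refine ⟨{v}, {w}, by simp, by simp, by simp [Ne.symm hwv], ?_, ?_⟩
      · intro x
        have : x ∈ S.erase v ↔ x = w := by simp [hw]
        simp only [Finset.mem_erase] at this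
        grind
      · have := hx v w
        simp; tauto
    · obtain ⟨X, Y, hX, hY, hd, hu, h1 | h1⟩ := ih R Q h hx _ hc (by omega)
      · exact step R Q h hx S v hv X Y hX hY hd hu h1
      · obtain ⟨X', Y', a1, a2, a3, a4, a5⟩ :=
          step Q R h.swap (fun x y h => hx x y h.symm) S v hv X Y hX hY hd hu h1
        exact ⟨X', Y', a1, a2, a3, a4, a5.symm⟩

theorem core_count {S b c d1 d2 : Finset V} (h : TG E N)
    (hb : b ⊆ S) (hc : c ⊆ S) (hd1 : d1 ⊆ S) (hd2 : d2 ⊆ S)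
    (bc : Disjoint b c) (bd1 : Disjoint b d1) (bd2 : Disjoint b d2) (cd1 : Disjoint c d1)
    (cd2 : Disjoint c d2) (dd : Disjoint d1 d2)
    (hg : ∀ x ∈ b, ∀ y ∈ c, E x y ∧ N x y)
    (hf : ∀ x ∈ d1, ∃ y, (y ∈ b ∨ y ∈ c) ∧ E x y ∧ N x y) :
    2 * (b.card * c.card) + 2 * d1.card + gg E N d2 ≤ gg E N S := by
  classical
  have : ∃ f : V → V, ∀ x ∈ d1, (f x ∈ b ∨ f x ∈ c) ∧ E x (f x) ∧ N x (f x) := by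
    choose! f hf using hf
    exact ⟨f, hf⟩
  obtain ⟨f, hf⟩ := this
  have sE := h.symE
  have sN := h.symN
  rw [Finset.disjoint_left] at bc bd1 bd2 cd1 cd2 dd
  have i3 : (d1.image (fun x => (x, f x))).card = d1.card :=
    Finset.card_image_of_injective _ (fun x y hxy => (Prod.ext_iff.1 hxy).1)
  have i4 : (d1.image (fun x => (f x, x))).card = d1.card :=
    Finset.card_image_of_injective _ (fun x y hxy => (Prod.ext_iff.1 hxy).2)
  unfold gg
  have e : ((b ×ˢ c) ∪ ((c ×ˢ b) ∪ ((d1.image (fun x => (x, f x))) ∪ ((d1.image (fun x => (f x, x))) ∪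
    ((d2 ×ˢ d2).filter (fun p => E p.1 p.2 ∧ N p.1 p.2)))))).card =
      b.card * c.card + (c.card * b.card + (d1.card + (d1.card +
        ((d2 ×ˢ d2).filter (fun p => E p.1 p.2 ∧ N p.1 p.2)).card))) := by
    rw [Finset.card_union_of_disjoint, Finset.card_union_of_disjoint,
      Finset.card_union_of_disjoint, Finset.card_union_of_disjoint, i3, i4,
      Finset.card_product, Finset.card_product]
    all_goals
      rw [Finset.disjoint_left]
      rintro ⟨x, y⟩ h1 h2
      simp only [Finset.mem_union, Finset.mem_filter, Finset.mem_product, Finset.mem_image,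
        Prod.mk.injEq] at h1 h2
      clear i3 i4 hb hc hd1 hd2 sE sN h hg
      grind
  have : 2 * (b.card * c.card) + 2 * d1.card +
     ((d2 ×ˢ d2).filter (fun p => E p.1 p.2 ∧ N p.1 p.2)).card =  b.card * c.card + (c.card * b.card + (d1.card + (d1.card +
        ((d2 ×ˢ d2).filter (fun p => E p.1 p.2 ∧ N p.1 p.2)).card))) := by ring
  rw [this, ← e]
  apply Finset.card_le_card
  rintro ⟨x, y⟩ h1
  simp only [Finset.mem_union, Finset.mem_filter, Finset.mem_product, Finset.mem_image,
        Prod.mk.injEq] at h1 ⊢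
  rcases h1 with h1 | h1 | ⟨z, hz, rfl, rfl⟩ | ⟨z, hz, rfl, rfl⟩ | h1
  · exact ⟨⟨hb h1.1, hc h1.2⟩, hg x h1.1 y h1.2⟩
  · have := hg y h1.2 x h1.1
    exact ⟨⟨hc h1.1, hb h1.2⟩, sE _ _ this.1, sN _ _ this.2⟩
  · have := hf z hz
    exact ⟨⟨hd1 hz, this.1.elim (fun q => hb q) (fun q => hc q)⟩, this.2⟩
  · have := hf z hz
    exact ⟨⟨this.1.elim (fun q => hb q) (fun q => hc q), hd1 hz⟩, sE _ _ this.2.1, sN _ _ this.2.2⟩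
  · exact ⟨⟨hd2 h1.1.1, hd2 h1.1.2⟩, h1.2⟩

theorem core (h : TG E N) {S b c d : Finset V} (hs : Sat E N S) (h3 : 3 ≤ S.card)
    (hb0 : b.Nonempty) (hc0 : c.Nonempty)
    (bc : Disjoint b c) (bd : Disjoint b d) (cd : Disjoint c d)
    (hS : ∀ x, x ∈ S ↔ x ∈ b ∨ x ∈ c ∨ x ∈ d)
    (hg : ∀ x ∈ b, ∀ y ∈ c, E x y ∧ N x y)
    (hbd : ∀ x ∈ b, ∀ y ∈ d, E x y) (hcd : ∀ x ∈ c, ∀ y ∈ d, N x y)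
    (ih : ∀ M ⊆ S, M.card < S.card → Sat E N M → 2 ≤ M.card → 2 * M.card + 2 ≤ 3 * gg E N M) :
    2 * S.card + 4 ≤ 3 * gg E N S := by
  classical
  have sE := h.symE
  have sN := h.symN
  have noP := h.noP
  unfold PP at noP
  obtain ⟨d1, hd1⟩ : ∃ d1, d1 = d.filter (fun x => ∃ y, (y ∈ b ∨ y ∈ c) ∧ E x y ∧ N x y) := ⟨_, rfl⟩
  obtain ⟨d2, hd2⟩ : ∃ d2, d2 = d.filter (fun x => ¬ ∃ y, (y ∈ b ∨ y ∈ c) ∧ E x y ∧ N x y) := ⟨_, rfl⟩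
  have hdd : d1.card + d2.card = d.card := by
    rw [hd1, hd2]; exact Finset.card_filter_add_card_filter_not _
  have hSc : S.card = b.card + (c.card + d.card) := by
    have : S = b ∪ (c ∪ d) := by ext x; simp [hS]
    rw [this, Finset.card_union_of_disjoint, Finset.card_union_of_disjoint cd]
    rw [Finset.disjoint_union_right]; exact ⟨bc, bd⟩
  have m1 : ∀ x ∈ d1, x ∈ d := by rw [hd1]; intro x hx; exact (Finset.mem_filter.1 hx).1
  have m2 : ∀ x ∈ d2, x ∈ d := by rw [hd2]; intro x hx; exact (Finset.mem_filter.1 hx).1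
  have hd2S : d2 ⊆ S := fun x hx => (hS x).2 (Or.inr (Or.inr (m2 x hx)))
  have f1 : ∀ x ∈ d1, ∃ y, (y ∈ b ∨ y ∈ c) ∧ E x y ∧ N x y := by
    rw [hd1]; intro x hx; exact (Finset.mem_filter.1 hx).2
  have f2 : ∀ x ∈ d2, ∀ y, (y ∈ b ∨ y ∈ c) → E x y → N x y → False := by
    rw [hd2]; intro x hx y hy h1 h2; exact (Finset.mem_filter.1 hx).2 ⟨y, hy, h1, h2⟩
  have f3 : ∀ x ∈ d, x ∉ d2 → x ∈ d1 := by
    rw [hd1, hd2]; intro x hx hx2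
    simp only [Finset.mem_filter] at hx2 ⊢
    exact ⟨hx, by by_contra hh; exact hx2 ⟨hx, hh⟩⟩
  have cnt := core_count (S := S) (b := b) (c := c) (d1 := d1) (d2 := d2) h
    (fun x hx => (hS x).2 (Or.inl hx)) (fun x hx => (hS x).2 (Or.inr (Or.inl hx)))
    (fun x hx => (hS x).2 (Or.inr (Or.inr (m1 x hx)))) hd2S bc
    (Finset.disjoint_of_subset_right m1 bd) (Finset.disjoint_of_subset_right m2 bd)
    (Finset.disjoint_of_subset_right m1 cd) (Finset.disjoint_of_subset_right m2 cd)
    (by rw [hd1, hd2]; exact Finset.disjoint_filter_filter_not _ _ _) hg f1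
  obtain ⟨β, hβ⟩ := hb0
  obtain ⟨γ, hγ⟩ := hc0
  have kb : 1 ≤ b.card := Finset.card_pos.2 ⟨β, hβ⟩
  have kc : 1 ≤ c.card := Finset.card_pos.2 ⟨γ, hγ⟩
  have k1 : b.card + c.card ≤ b.card * c.card + 1 := by nlinarith
  have four : 1 ≤ d2.card → 4 ≤ S.card := by
    intro hd
    obtain ⟨y, hy⟩ := Finset.card_pos.1 hd
    have hyd := m2 y hy
    refine hs.four h (hd2S hy) ((hS β).2 (Or.inl hβ)) ?_ (fun hh => f2 y hy β (Or.inl hβ) hh.1 hh.2)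
    rintro rfl
    exact Finset.disjoint_left.1 bd hβ hyd
  have two : 2 ≤ d2.card → 2 * d2.card + 2 ≤ 3 * gg E N d2 := by
    intro hc2
    apply ih d2 hd2S (by omega) _ hc2
    apply hs.hom h hd2S
    intro z hz hzd
    rcases (hS z).1 hz with hz | hz | hz
    · right
      intro y hy hn
      exact f2 y hy z (Or.inl hz) (sE _ _ (hbd z hz y (m2 y hy))) (sN _ _ hn)
    · left
      intro y hy hn
      exact f2 y hy z (Or.inr hz) (sE _ _ hn) (sN _ _ (hcd z hz y (m2 y hy)))
    · obtain ⟨w, hw, e, n⟩ := f1 z (f3 z hz hzd)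
      rcases hw with hw | hw
      · left
        intro y hy he
        exact noP γ w y z ⟨sE _ _ (hg w hw γ hγ).1, hbd w hw y (m2 y hy), sE _ _ he,
          hcd γ hγ y (m2 y hy), sN _ _ n, hcd γ hγ z hz⟩
      · right
        intro y hy hn
        exact noP w z β y ⟨sE _ _ e, sE _ _ (hbd β hβ z hz), hbd β hβ y (m2 y hy),
          sN _ _ (hg β hβ w hw).2, hn, hcd w hw y (m2 y hy)⟩
  rcases Nat.lt_or_ge d2.card 2 with hlt | hge
  · rcases Nat.lt_or_ge d2.card 1 with hl1 | hg1
    · omega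
    · have := four hg1
      omega
  · have := two hge
    omega

theorem univ_case (h : TG E N) {S : Finset V} (hs : Sat E N S) (h3 : 3 ≤ S.card) {v : V}
    (hv : v ∈ S) (hu : Univ E S v)
    (ih : ∀ M ⊆ S, M.card < S.card → Sat E N M → 3 ≤ M.card →
      (¬ ∃ v ∈ M, Univ E M v ∨ Univ N M v) → 2 * M.card + 4 ≤ 3 * gg E N M) :
    2 * S.card + 2 ≤ 3 * gg E N S := by
  classical
  have sE := h.symE
  have sN := h.symN
  have hcard : (S.erase v).card + 1 = S.card := Finset.card_erase_add_one hv
  obtain ⟨w, hw⟩ : (S.erase v).Nonempty := by rw [← Finset.card_pos]; omega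
  obtain ⟨hwv, hwS⟩ := Finset.mem_erase.1 hw
  have h4 := hs.four h hv hwS (Ne.symm hwv) (fun hh => hu w hwS hwv hh.1)
  have hsub : S.erase v ⊆ S := Finset.erase_subset _ _
  have hM : Sat E N (S.erase v) := by
    apply hs.hom h hsub
    intro z hz hz2
    have : z = v := by by_contra hne; exact hz2 (Finset.mem_erase.2 ⟨hne, hz⟩)
    subst this
    left
    intro y hy
    exact hu y (hsub hy) (Finset.mem_erase.1 hy).1
  have := ih _ hsub (by omega) hM (by omega) ?_
  · have := gg_mono (E := E) (N := N) hsub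
    omega
  · rintro ⟨u, hu1, hu2⟩
    obtain ⟨huv, huS⟩ := Finset.mem_erase.1 hu1
    obtain ⟨a, ha, b, hb, c, hc, d, hd, p1, p2, p3, p4, p5, p6⟩ :=
      hs v hv u huS (Ne.symm huv) (fun hh => hu u huS huv hh.1)
    have noP := h.noP a b c d
    have irE := h.irE
    have irN := h.irN
    unfold PP at noP
    unfold Univ at hu hu2
    simp only [Finset.mem_erase] at hu2
    have hE := fun x (hx : x ∈ S) (e : Fl E v u v x) => show x = u by unfold Fl at e; grind
    have sE' : ∀ x y, Fl E v u x y → Fl E v u y x := fun x y => Fl.symm h.symE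
    have sN' : ∀ x y, Fl N v u x y → Fl N v u y x := fun x y => Fl.symm h.symN
    have q1 := sE' _ _ p1
    have q2 := sE' _ _ p2
    have q3 := sE' _ _ p3
    have q4 := sN' _ _ p4
    have q5 := sN' _ _ p5
    have q6 := sN' _ _ p6
    -- v is an endpoint
    have irF : ∀ x, ¬ Fl E v u x x := by intro x; unfold Fl; grind
    have irFN : ∀ x, ¬ Fl N v u x x := by intro x; unfold Fl; grind
    have key : ∀ x ∈ S, ∀ y ∈ S, Fl E v u u x → x ≠ v → Fl N v u u y → y ≠ v → False := by
      intro x hx y hy e hxv n hyv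
      have hxu : x ≠ u := by rintro rfl; exact irF _ e
      have hyu : y ≠ u := by rintro rfl; exact irFN _ n
      unfold Fl at e n
      rcases hu2 with k | k
      · exact k x ⟨hxv, hx⟩ hxu (by tauto)
      · exact k y ⟨hyv, hy⟩ hyu (by tauto)
    by_cases va : a = v
    · subst va
      have := hE b hb p1
      subst this
      exact key c hc d hd p2 (by rintro rfl; exact irFN _ p4) p5 (by rintro rfl; exact irFN _ p6)
    by_cases vd : d = v
    · subst vd
      have := hE c hc q3
      subst this
      exact key b hb a ha q2 (by rintro rfl; exact irFN _ p5) q4 (by rintro rfl; exact irFN _ p6)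
    by_cases vb : b = v
    · subst vb
      have h1 := hE a ha q1
      have h2 := hE c hc p2
      subst h1
      subst h2
      exact irFN _ p4
    by_cases vc : c = v
    · subst vc
      have h1 := hE b hb q2
      have h2 := hE d hd p3
      subst h1
      subst h2
      exact irFN _ p5
    have st : ∀ (R : V → V → Prop) x y, x ≠ v → y ≠ v → Fl R v u x y → R x y := by
      rintro R x y hx hy (h | h | h)
      · exact h
      · exact absurd h.1 hx
      · exact absurd h.2 hy
    exact noP ⟨st _ _ _ va vb p1, st _ _ _ vb vc p2, st _ _ _ vc vd p3, st _ _ _ va vc p4,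
      st _ _ _ vb vd p5, st _ _ _ va vd p6⟩

theorem gray2 (h : TG E N) {S : Finset V} (hs : Sat E N S) (h2 : S.card = 2) : 2 ≤ gg E N S := by
  classical
  obtain ⟨x, y, hxy, rfl⟩ := Finset.card_eq_two.1 h2
  have hg : E x y ∧ N x y := by
    by_contra hh
    have := hs.four h (u := x) (v := y) (by simp) (by simp) hxy hh
    omega
  have : ({(x, y), (y, x)} : Finset (V × V)).card = 2 := Finset.card_pair (by simp [hxy])
  rw [← this]
  unfold gg
  apply Finset.card_le_card
  intro p
  have := h.symE x y hg.1
  have := h.symN x y hg.2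
  simp only [Finset.mem_insert, Finset.mem_singleton, Finset.mem_filter, Finset.mem_product]
  rintro (rfl | rfl) <;> simp <;> tauto

theorem split_case (h : TG E N) {S X Y : Finset V} (hs : Sat E N S)
    (hX : X.Nonempty) (hY : Y.Nonempty) (hd : Disjoint X Y) (hS : ∀ x, x ∈ S ↔ x ∈ X ∨ x ∈ Y)
    (hXY : ∀ x ∈ X, ∀ y ∈ Y, ¬ E x y) (hu : ¬ ∃ v ∈ S, Univ E S v)
    (ih : ∀ M ⊆ S, M.card < S.card → Sat E N M → 2 ≤ M.card → 2 * M.card + 2 ≤ 3 * gg E N M) :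
    2 * S.card + 4 ≤ 3 * gg E N S := by
  classical
  have sE := h.symE
  have hc : S.card = X.card + Y.card := by
    rw [← Finset.card_union_of_disjoint hd]; congr 1; ext x; simp [hS]
  have hXS : X ⊆ S := fun x hx => (hS x).2 (Or.inl hx)
  have hYS : Y ⊆ S := fun x hx => (hS x).2 (Or.inr hx)
  have x1 := Finset.card_pos.2 hX
  have y1 := Finset.card_pos.2 hY
  have x2 : X.card ≠ 1 := by
    intro hh
    obtain ⟨v, rfl⟩ := Finset.card_eq_one.1 hh
    apply hu
    refine ⟨v, hXS (by simp), fun x hx hxv => ?_⟩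
    have := (hS x).1 hx
    simp [hxv] at this
    exact hXY v (by simp) x this
  have y2 : Y.card ≠ 1 := by
    intro hh
    obtain ⟨v, rfl⟩ := Finset.card_eq_one.1 hh
    apply hu
    refine ⟨v, hYS (by simp), fun x hx hxv => ?_⟩
    have := (hS x).1 hx
    simp [hxv] at this
    exact fun e => hXY x this v (by simp) (sE _ _ e)
  have sX : Sat E N X := by
    apply hs.hom h hXS
    intro z hz hzX
    have := ((hS z).1 hz).resolve_left hzX
    exact Or.inl fun y hy e => hXY y hy z this (sE _ _ e)
  have sY : Sat E N Y := by
    apply hs.hom h hYS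
    intro z hz hzX
    have := ((hS z).1 hz).resolve_right hzX
    exact Or.inl fun y hy e => hXY z this y hy e
  have a1 := ih X hXS (by omega) sX (by omega)
  have a2 := ih Y hYS (by omega) sY (by omega)
  have := gg_add (E := E) (N := N) hXS hYS hd
  omega

theorem lower (h : TG E N) (m : ℕ) : ∀ S : Finset V, S.card = m → Sat E N S →
    (2 ≤ S.card → 2 * S.card + 2 ≤ 3 * gg E N S) ∧
    (3 ≤ S.card → (¬ ∃ v ∈ S, Univ E S v ∨ Univ N S v) → 2 * S.card + 4 ≤ 3 * gg E N S) := by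
  classical
  induction m using Nat.strong_induction_on with
  | _ m ih =>
  intro S hm hs
  have ih1 : ∀ M ⊆ S, M.card < S.card → Sat E N M → 2 ≤ M.card → 2 * M.card + 2 ≤ 3 * gg E N M :=
    fun M _ hlt hM => (ih M.card (by omega) M rfl hM).1
  have ih2 : ∀ M ⊆ S, M.card < S.card → Sat E N M → 3 ≤ M.card →
      (¬ ∃ v ∈ M, Univ E M v ∨ Univ N M v) → 2 * M.card + 4 ≤ 3 * gg E N M :=
    fun M _ hlt hM => (ih M.card (by omega) M rfl hM).2
  have claim : (3 ≤ S.card → (¬ ∃ v ∈ S, Univ E S v ∨ Univ N S v) →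
      2 * S.card + 4 ≤ 3 * gg E N S) := by
    intro h3 hu
    have tE : TG E (fun x y => x ≠ y ∧ ¬ E x y) := by
      refine ⟨h.symE, fun x y hh => ⟨hh.1.symm, fun e => hh.2 (h.symE _ _ e)⟩, h.irE, by simp,
        fun x y hh => by tauto, ?_⟩
      rintro a b c d ⟨p1, p2, p3, p4, p5, p6⟩
      exact h.noP a b c d ⟨p1, p2, p3, (h.tot _ _ p4.1).resolve_left p4.2,
        (h.tot _ _ p5.1).resolve_left p5.2, (h.tot _ _ p6.1).resolve_left p6.2⟩
    have h' := h.swap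
    have tN : TG N (fun x y => x ≠ y ∧ ¬ N x y) := by
      refine ⟨h'.symE, fun x y hh => ⟨hh.1.symm, fun e => hh.2 (h'.symE _ _ e)⟩, h'.irE, by simp,
        fun x y hh => by tauto, ?_⟩
      rintro a b c d ⟨p1, p2, p3, p4, p5, p6⟩
      exact h'.noP a b c d ⟨p1, p2, p3, (h'.tot _ _ p4.1).resolve_left p4.2,
        (h'.tot _ _ p5.1).resolve_left p5.2, (h'.tot _ _ p6.1).resolve_left p6.2⟩
    obtain ⟨X, Y, hX, hY, hd, hS, hXY⟩ := seinsche S.card _ _ tE (fun x y => by tauto) S rfl (by omega)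
    rcases hXY with hXY | hXY
    · exact split_case h hs hX hY hd hS hXY (fun ⟨v, a, b⟩ => hu ⟨v, a, Or.inl b⟩) ih1
    obtain ⟨X', Y', hX', hY', hd', hS', hXY'⟩ :=
      seinsche S.card _ _ tN (fun x y => by tauto) S rfl (by omega)
    rcases hXY' with hXY' | hXY'
    · rw [← gg_swap]
      refine split_case h.swap (hs.swap h) hX' hY' hd' hS' hXY' (fun ⟨v, a, b⟩ => hu ⟨v, a, Or.inr b⟩) ?_
      intro M h1 h2 h3 h4
      rw [gg_swap]; exact ih1 M h1 h2 (h3.swap h.swap) h4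
    rw [Finset.disjoint_left] at hd hd'
    have e1 : ∀ x ∈ X, ∀ y ∈ Y, E x y := by
      intro x hx y hy
      have := hXY x hx y hy
      by_contra he
      exact this ⟨by rintro rfl; exact hd hx hy, he⟩
    have e2 : ∀ x ∈ X', ∀ y ∈ Y', N x y := by
      intro x hx y hy
      have := hXY' x hx y hy
      by_contra he
      exact this ⟨by rintro rfl; exact hd' hx hy, he⟩
    have sE := h.symE
    have sN := h.symN
    have e1' : ∀ x ∈ X, ∀ y ∈ Y, E y x := fun x hx y hy => sE _ _ (e1 x hx y hy)
    have e2' : ∀ x ∈ X', ∀ y ∈ Y', N y x := fun x hx y hy => sN _ _ (e2 x hx y hy)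
    have fin : ∀ A A' D : Finset V, A.Nonempty → A'.Nonempty →
      Disjoint A A' → Disjoint A D → Disjoint A' D →
      (∀ x, x ∈ S ↔ x ∈ A ∨ x ∈ A' ∨ x ∈ D) → (∀ x ∈ A, ∀ y ∈ A', E x y ∧ N x y) →
      (∀ x ∈ A, ∀ y ∈ D, E x y) → (∀ x ∈ A', ∀ y ∈ D, N x y) → 2 * S.card + 4 ≤ 3 * gg E N S :=
      fun A A' D a1 a2 a3 a4 a5 a6 a7 a8 a9 => core h hs h3 a1 a2 a3 a4 a5 a6 a7 a8 a9 ih1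
    by_cases ca : ∀ x ∈ X, x ∉ X'
    · apply fin X X' (S.filter (fun x => x ∉ X ∧ x ∉ X')) hX hX' <;>
        first | (rw [Finset.disjoint_left]; grind) | grind
    by_cases cb : ∀ x ∈ X, x ∉ Y'
    · apply fin X Y' (S.filter (fun x => x ∉ X ∧ x ∉ Y')) hX hY' <;>
        first | (rw [Finset.disjoint_left]; grind) | grind
    by_cases cc : ∀ x ∈ Y, x ∉ X'
    · apply fin Y X' (S.filter (fun x => x ∉ Y ∧ x ∉ X')) hY hX' <;>
        first | (rw [Finset.disjoint_left]; grind) | grind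
    by_cases cd : ∀ x ∈ Y, x ∉ Y'
    · apply fin Y Y' (S.filter (fun x => x ∉ Y ∧ x ∉ Y')) hY hY' <;>
        first | (rw [Finset.disjoint_left]; grind) | grind
    push Not at ca cb cc cd
    obtain ⟨a, ha, ha'⟩ := ca
    obtain ⟨b, hb, hb'⟩ := cb
    obtain ⟨c, hc, hc'⟩ := cc
    obtain ⟨d, hd1, hd1'⟩ := cd
    exact absurd ⟨e1' a ha c hc, e1 a ha d hd1, e1' b hb d hd1, e2 c hc' d hd1',
      e2 a ha' b hb', e2 c hc' b hb'⟩ (h.noP c a d b)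
  refine ⟨fun h2 => ?_, claim⟩
  rcases Nat.eq_or_lt_of_le h2 with h2 | h3
  · have := gray2 h hs h2.symm
    omega
  · by_cases hu : ∃ v ∈ S, Univ E S v ∨ Univ N S v
    · obtain ⟨v, hv, hu | hu⟩ := hu
      · exact univ_case h hs h3 hv hu ih2
      · rw [← gg_swap]
        refine univ_case h.swap (hs.swap h) h3 hv hu ?_
        intro M h1 h2 h3 h4 h5
        rw [gg_swap]
        exact ih2 M h1 h2 (h3.swap h.swap) h4 (fun ⟨v, a, b⟩ => h5 ⟨v, a, b.symm⟩)
    · have := claim h3 hu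
      omega

def eE (T : Trigraph V) (x y : V) : Prop := T.black.Adj x y ∨ T.gray.Adj x y
def nN (T : Trigraph V) (x y : V) : Prop := x ≠ y ∧ ¬ T.black.Adj x y

theorem gray_iff (T : Trigraph V) (x y : V) : T.gray.Adj x y ↔ eE T x y ∧ nN T x y := by
  have := T.disjoint x y
  have h : T.gray.Adj x y → x ≠ y := fun h => h.ne
  unfold eE nN
  tauto

theorem symE_T (T : Trigraph V) (x y : V) (h : eE T x y) : eE T y x := by
  unfold eE at *
  rwa [T.black.adj_comm, T.gray.adj_comm]

theorem symN_T (T : Trigraph V) (x y : V) (h : nN T x y) : nN T y x := by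
  unfold nN at *
  rw [T.black.adj_comm]
  exact ⟨h.1.symm, h.2⟩

theorem irE_T (T : Trigraph V) (x : V) : ¬ eE T x x := by simp [eE]
theorem irN_T (T : Trigraph V) (x : V) : ¬ nN T x x := by simp [nN]

theorem real_iff (T : Trigraph V) :
    (∃ R, T.IsRealization R ∧ Trigraph.HasInducedCopy (SimpleGraph.pathGraph 4) R) ↔
      ∃ a b c d, PP (eE T) (nN T) a b c d := by
  constructor
  · rintro ⟨R, ⟨h1, h2⟩, ⟨f⟩⟩
    have e : ∀ i j : Fin 4, (i.val + 1 = j.val ∨ j.val + 1 = i.val) → eE T (f i) (f j) := by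
      intro i j hij
      have : R.Adj (f i) (f j) := f.map_rel_iff.2 (SimpleGraph.pathGraph_adj.2 hij)
      have := h2 this
      simpa [eE] using this
    have n : ∀ i j : Fin 4, i ≠ j → ¬ (i.val + 1 = j.val ∨ j.val + 1 = i.val) → nN T (f i) (f j) := by
      intro i j hne hij
      refine ⟨fun hh => hne (f.injective hh), fun hb => hij ?_⟩
      have : R.Adj (f i) (f j) := h1 hb
      exact SimpleGraph.pathGraph_adj.1 (f.map_rel_iff.1 this)
    exact ⟨f 0, f 1, f 2, f 3, e _ _ (by decide), e _ _ (by decide), e _ _ (by decide),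
      n _ _ (by decide) (by decide), n _ _ (by decide) (by decide), n _ _ (by decide) (by decide)⟩
  · rintro ⟨a, b, c, d, p1, p2, p3, p4, p5, p6⟩
    have irE := irE_T T
    have irN := irN_T T
    have e1 : a ≠ b := by rintro rfl; exact irE _ p1
    have e2 : a ≠ c := p4.1
    have e3 : a ≠ d := p6.1
    have e4 : b ≠ c := by rintro rfl; exact irE _ p2
    have e5 : b ≠ d := p5.1
    have e6 : c ≠ d := by rintro rfl; exact irE _ p3
    let K : V → V → Prop := fun x y => (x = a ∧ y = b) ∨ (x = b ∧ y = c) ∨ (x = c ∧ y = d)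
    let R : SimpleGraph V :=
      { Adj := fun x y => T.black.Adj x y ∨ (T.gray.Adj x y ∧ (K x y ∨ K y x))
        symm := ⟨fun x y h => by rwa [T.black.adj_comm, T.gray.adj_comm, or_comm (a := K y x)]⟩
        loopless := ⟨fun x h => by simp at h⟩ }
    have hR : ∀ x y, R.Adj x y ↔ T.black.Adj x y ∨ (T.gray.Adj x y ∧ (K x y ∨ K y x)) :=
      fun _ _ => Iff.rfl
    refine ⟨R, ⟨fun x y h => Or.inl h, fun x y h => ?_⟩, ?_⟩
    · rw [hR] at h
      rw [SimpleGraph.sup_adj]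
      tauto
    · have r1 : R.Adj a b := by
        rw [hR]; rcases p1 with h | h
        · exact Or.inl h
        · exact Or.inr ⟨h, Or.inl (Or.inl ⟨rfl, rfl⟩)⟩
      have r2 : R.Adj b c := by
        rw [hR]; rcases p2 with h | h
        · exact Or.inl h
        · exact Or.inr ⟨h, Or.inl (Or.inr (Or.inl ⟨rfl, rfl⟩))⟩
      have r3 : R.Adj c d := by
        rw [hR]; rcases p3 with h | h
        · exact Or.inl h
        · exact Or.inr ⟨h, Or.inl (Or.inr (Or.inr ⟨rfl, rfl⟩))⟩
      have r4 : ¬ R.Adj a c := by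
        rw [hR]; rintro (h | ⟨-, h⟩)
        · exact p4.2 h
        · simp only [K] at h; grind
      have r5 : ¬ R.Adj b d := by
        rw [hR]; rintro (h | ⟨-, h⟩)
        · exact p5.2 h
        · simp only [K] at h; grind
      have r6 : ¬ R.Adj a d := by
        rw [hR]; rintro (h | ⟨-, h⟩)
        · exact p6.2 h
        · simp only [K] at h; grind
      refine ⟨⟨⟨![a, b, c, d], ?_⟩, ?_⟩⟩
      · intro i j hij
        fin_cases i <;> fin_cases j <;> simp at hij ⊢ <;> grind
      · intro i j
        have s := R.adj_comm
        have ir : ∀ x, ¬ R.Adj x x := fun x => R.irrefl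
        rw [SimpleGraph.pathGraph_adj]
        change R.Adj (![a, b, c, d] i) (![a, b, c, d] j) ↔ _
        fin_cases i <;> fin_cases j <;> simp [r1, r2, r3, r4, r5, r6, ir, r1.symm, r2.symm, r3.symm,
          s c a, s d b, s d a]

theorem flip_E (T : Trigraph V) {u v : V} (h : u ≠ v) (x y : V) :
    eE (T.flip u v) x y ↔ Fl (eE T) u v x y := by
  simp only [eE, Fl, Trigraph.flip, Trigraph.single, SimpleGraph.sdiff_adj, SimpleGraph.sup_adj,
    SimpleGraph.fromEdgeSet_adj, Set.mem_singleton_iff, Sym2.eq_iff]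
  grind

theorem flip_N (T : Trigraph V) {u v : V} (h : u ≠ v) (x y : V) :
    nN (T.flip u v) x y ↔ Fl (nN T) u v x y := by
  simp only [nN, Fl, Trigraph.flip, Trigraph.single, SimpleGraph.sdiff_adj, SimpleGraph.sup_adj,
    SimpleGraph.fromEdgeSet_adj, Set.mem_singleton_iff, Sym2.eq_iff]
  grind

theorem indsat_iff [Fintype V] (T : Trigraph V) :
    Trigraph.IsIndSat (SimpleGraph.pathGraph 4) T ↔
      TG (eE T) (nN T) ∧ Sat (eE T) (nN T) Finset.univ := by
  have hfl : ∀ u v, u ≠ v → ((∃ R, (T.flip u v).IsRealization R ∧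
      Trigraph.HasInducedCopy (SimpleGraph.pathGraph 4) R) ↔
      ∃ a b c d, PP (Fl (eE T) u v) (Fl (nN T) u v) a b c d) := by
    intro u v huv
    rw [real_iff]
    have h1 : eE (T.flip u v) = Fl (eE T) u v := by ext x y; exact flip_E T huv x y
    have h2 : nN (T.flip u v) = Fl (nN T) u v := by ext x y; exact flip_N T huv x y
    rw [h1, h2]
  constructor
  · rintro ⟨h1, h2⟩
    refine ⟨⟨symE_T T, symN_T T, irE_T T, irN_T T, ?_, ?_⟩, ?_⟩
    · intro x y h; unfold eE nN; tauto
    · intro a b c d hp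
      obtain ⟨R, hR, hc⟩ := (real_iff T).2 ⟨a, b, c, d, hp⟩
      exact h1 R hR hc
    · intro u _ v _ huv hg
      rw [← gray_iff] at hg
      obtain ⟨a, b, c, d, hp⟩ := (hfl u v huv).1 (h2 u v huv hg)
      exact ⟨a, by simp, b, by simp, c, by simp, d, by simp, hp⟩
  · rintro ⟨h1, h2⟩
    refine ⟨fun R hR hc => ?_, fun u v huv hg => ?_⟩
    · obtain ⟨a, b, c, d, hp⟩ := (real_iff T).1 ⟨R, hR, hc⟩
      exact h1.noP a b c d hp
    · rw [gray_iff] at hg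
      obtain ⟨a, _, b, _, c, _, d, _, hp⟩ := h2 u (by simp) v (by simp) huv hg
      exact (hfl u v huv).2 ⟨a, b, c, d, hp⟩

theorem gg_le [Fintype V] (T : Trigraph V) :
    gg (eE T) (nN T) Finset.univ ≤ 2 * T.gray.edgeSet.ncard := by
  classical
  rw [← SimpleGraph.coe_edgeFinset, Set.ncard_coe_finset, ← SimpleGraph.dart_card_eq_twice_card_edges]
  unfold gg
  rw [← Finset.card_univ]
  refine le_trans (Finset.card_le_card ?_) (Finset.card_image_le (f := fun d : T.gray.Dart => d.toProd))
  rintro ⟨x, y⟩ hp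
  simp only [Finset.mem_filter] at hp
  rw [Finset.mem_image]
  exact ⟨⟨(x, y), (gray_iff T x y).2 hp.2⟩, by simp, rfl⟩

theorem lower_T [Fintype V] (T : Trigraph V) (hT : Trigraph.IsIndSat (SimpleGraph.pathGraph 4) T)
    (hc : 2 ≤ Fintype.card V) : Fintype.card V + 1 ≤ 3 * T.gray.edgeSet.ncard := by
  obtain ⟨h1, h2⟩ := (indsat_iff T).1 hT
  have := (lower h1 _ Finset.univ rfl h2).1 (by simpa using hc)
  have h3 := gg_le T
  rw [Finset.card_univ] at this
  omega

/-- a witness with at most `k` gray edges in which each vertex has a possible non-neighbour -/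
def Good (V : Type) [Fintype V] (k : ℕ) : Prop :=
  ∃ E N : V → V → Prop, TG E N ∧ Sat E N Finset.univ ∧ (∀ x, ∃ y, N x y) ∧
    ∃ F : Finset (Sym2 V), (∀ x y, E x y → N x y → s(x, y) ∈ F) ∧ F.card ≤ k

theorem good_base (j : ℕ) : Good (Fin j × Bool) j := by
  refine ⟨fun p q => p.1 = q.1 ∧ p.2 ≠ q.2, fun p q => p ≠ q, ?_, ?_, ?_, ?_⟩
  · refine ⟨fun x y h => ⟨h.1.symm, h.2.symm⟩, fun x y h => h.symm, by simp, by simp, by tauto, ?_⟩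
    rintro ⟨a, a'⟩ ⟨b, b'⟩ ⟨c, c'⟩ ⟨d, d'⟩ ⟨p1, p2, p3, p4, p5, p6⟩
    simp only at p1 p2 p3
    apply p4
    have : a' = c' := by
      have h1 := p1.2
      have h2 := p2.2
      clear p1 p2 p3 p4 p5 p6
      revert a' b' c'
      decide
    rw [p1.1, p2.1, this]
  · rintro ⟨i, x⟩ - ⟨i', y⟩ - hne hg
    simp only [ne_eq, Prod.mk.injEq] at hg hne
    have hi : i ≠ i' := by tauto
    refine ⟨(i, !x), by simp, (i, x), by simp, (i', y), by simp, (i', !y), by simp, ?_⟩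
    refine ⟨?_, ?_, ?_, ?_, ?_, ?_⟩ <;> simp [Fl, hi]
  · rintro ⟨i, x⟩
    exact ⟨(i, !x), by simp⟩
  · refine ⟨Finset.univ.image (fun i : Fin j => s((i, true), (i, false))), ?_, ?_⟩
    · rintro ⟨i, x⟩ ⟨i', y⟩ ⟨h1, h2⟩ -
      simp only at h1 h2
      subst h1
      rw [Finset.mem_image]
      refine ⟨i, by simp, ?_⟩
      cases x <;> cases y <;> simp at h2 ⊢
    · exact Finset.card_image_le.trans (by simp)

def stepE (E : V → V → Prop) : V ⊕ Fin 3 → V ⊕ Fin 3 → Prop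
  | .inl x, .inl y => E x y
  | .inl _, .inr i => i ≠ 2
  | .inr i, .inl _ => i ≠ 2
  | .inr i, .inr j => i ≠ j ∧ i ≠ 2 ∧ j ≠ 2

def stepN (N : V → V → Prop) : V ⊕ Fin 3 → V ⊕ Fin 3 → Prop
  | .inl x, .inl y => N x y
  | .inl _, .inr i => i = 2
  | .inr i, .inl _ => i = 2
  | .inr i, .inr j => i ≠ j

theorem step_noP (h : TG E N) (a b c d : V ⊕ Fin 3) : ¬ PP (stepE E) (stepN N) a b c d := by
  have noP := h.noP
  rintro ⟨p1, p2, p3, p4, p5, p6⟩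
  rcases a with a | a <;> rcases b with b | b <;> rcases c with c | c <;> rcases d with d | d <;>
    simp only [stepE, stepN] at p1 p2 p3 p4 p5 p6 <;>
    first
    | exact noP a b c d ⟨p1, p2, p3, p4, p5, p6⟩
    | contradiction
    | omega

theorem good_step {V : Type} [Fintype V] [Nonempty V] {k : ℕ} (hG : Good V k) :
    Good (V ⊕ Fin 3) (k + 1) := by
  classical
  obtain ⟨E, N, h, hs, hn, F, hF, hFk⟩ := hG
  have tg : TG (stepE E) (stepN N) := by
    refine ⟨?_, ?_, ?_, ?_, ?_, step_noP h⟩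
    · rintro (x | x) (y | y) <;> simp only [stepE]
      · exact h.symE x y
      · exact id
      · exact id
      · tauto
    · rintro (x | x) (y | y) <;> simp only [stepN]
      · exact h.symN x y
      · exact id
      · exact id
      · tauto
    · rintro (x | x) <;> simp [stepE, h.irE]
    · rintro (x | x) <;> simp [stepN, h.irN]
    · rintro (x | x) (y | y) hxy <;> simp only [stepE, stepN]
      · exact h.tot x y (by simpa using hxy)
      · tauto
      · tauto
      · right; simpa using hxy
  refine ⟨stepE E, stepN N, tg, ?_, ?_, ?_⟩
  · -- the relation is symmetric in u, v
    have symm : ∀ u v, (∃ a b c d, PP (Fl (stepE E) u v) (Fl (stepN N) u v) a b c d) →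
        ∃ a b c d, PP (Fl (stepE E) v u) (Fl (stepN N) v u) a b c d := by
      rintro u v ⟨a, b, c, d, hp⟩
      refine ⟨a, b, c, d, ?_⟩
      have e : ∀ R : V ⊕ Fin 3 → V ⊕ Fin 3 → Prop, Fl R v u = Fl R u v := by
        intro R; ext x y; unfold Fl; tauto
      rwa [e, e]
    have oth : ∀ i : Fin 3, i ≠ 2 → ∃ j : Fin 3, j ≠ i ∧ j ≠ 2 := by decide
    have k1 : ∀ (x : V) (i : Fin 3),
        ∃ a b c d, PP (Fl (stepE E) (.inl x) (.inr i)) (Fl (stepN N) (.inl x) (.inr i)) a b c d := by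
      intro x i
      obtain ⟨y, hy⟩ := hn x
      by_cases hi : i = 2
      · subst hi
        refine ⟨.inr 2, .inl x, .inr 0, .inl y, ?_⟩
        refine ⟨?_, ?_, ?_, ?_, ?_, ?_⟩ <;> simp [Fl, stepE, stepN, hy]
      · obtain ⟨j, hji, hj⟩ := oth i hi
        -- complement path y, x, i, j
        refine ⟨.inl x, .inr j, .inl y, .inr i, ?_⟩
        refine ⟨?_, ?_, ?_, ?_, ?_, ?_⟩ <;> simp [Fl, stepE, stepN, hy, hi, hj, hji]
    have k2 : ∀ i : Fin 3, i ≠ 2 →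
        ∃ a b c d, PP (Fl (stepE E) (.inr 2) (.inr i)) (Fl (stepN N) (.inr 2) (.inr i)) a b c d := by
      intro i hi
      obtain ⟨j, hji, hj⟩ := oth i hi
      obtain ⟨x⟩ := ‹Nonempty V›
      refine ⟨.inr 2, .inr i, .inl x, .inr j, ?_⟩
      refine ⟨?_, ?_, ?_, ?_, ?_, ?_⟩ <;> simp [Fl, stepE, stepN, hi, hj, Ne.symm hji, Ne.symm hj]
    have main : ∀ u v, u ≠ v → ¬ (stepE E u v ∧ stepN N u v) →
        ∃ a b c d, PP (Fl (stepE E) u v) (Fl (stepN N) u v) a b c d := by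
      rintro (u | u) (v | v) huv hg
      · obtain ⟨a, _, b, _, c, _, d, _, p1, p2, p3, p4, p5, p6⟩ :=
          hs u (by simp) v (by simp) (by simpa using huv) hg
        refine ⟨.inl a, .inl b, .inl c, .inl d, ?_⟩
        simp only [PP, Fl, stepE, stepN, Sum.inl.injEq]
        exact ⟨p1, p2, p3, p4, p5, p6⟩
      · exact k1 u v
      · exact symm _ _ (k1 v u)
      · simp only [stepE, stepN] at hg
        have huv' : u ≠ v := by simpa using huv
        by_cases hu : u = 2
        · subst hu; exact k2 v (Ne.symm huv')
        by_cases hv : v = 2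
        · subst hv; exact symm _ _ (k2 u hu)
        tauto
    intro u _ v _ huv hg
    obtain ⟨a, b, c, d, hp⟩ := main u v huv hg
    exact ⟨a, by simp, b, by simp, c, by simp, d, by simp, hp⟩
  · obtain ⟨z⟩ := ‹Nonempty V›
    rintro (x | i)
    · exact ⟨.inr 2, rfl⟩
    · by_cases hi : i = 2
      · exact ⟨.inl z, hi⟩
      · exact ⟨.inr 2, hi⟩
  · refine ⟨insert s(.inr 0, .inr 1) (F.image (Sym2.map Sum.inl)), ?_, ?_⟩
    · rintro (x | x) (y | y) he hn
      · rw [Finset.mem_insert, Finset.mem_image]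
        exact Or.inr ⟨s(x, y), hF x y he hn, by simp⟩
      · exact absurd hn he
      · exact absurd hn he
      · rw [Finset.mem_insert]
        left
        obtain ⟨h1, h2, h3⟩ := he
        rw [Sym2.eq_iff, Sum.inr.injEq, Sum.inr.injEq, Sum.inr.injEq, Sum.inr.injEq]
        clear hn
        revert x y
        decide
    · exact (Finset.card_insert_le _ _).trans
        (Nat.add_le_add_right (Finset.card_image_le.trans hFk) 1)

theorem good_iter (j t : ℕ) (hj : 1 ≤ j) : ∃ (V : Type) (_ : Fintype V) (_ : Nonempty V),
    Fintype.card V = 2 * j + 3 * t ∧ Good V (j + t) := by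
  induction t with
  | zero =>
    refine ⟨Fin j × Bool, inferInstance, ⟨(⟨0, hj⟩, true)⟩, ?_, good_base j⟩
    simp; omega
  | succ t ih =>
    obtain ⟨V, _, _, hc, hg⟩ := ih
    refine ⟨V ⊕ Fin 3, inferInstance, inferInstance, ?_, good_step hg⟩
    rw [Fintype.card_sum, hc, Fintype.card_fin]; ring

theorem good_fin {V : Type} [Fintype V] {k n : ℕ} (hG : Good V k) (hc : Fintype.card V = n) :
    ∃ T : Trigraph (Fin n), Trigraph.IsIndSat (SimpleGraph.pathGraph 4) T ∧
      T.gray.edgeSet.ncard ≤ k := by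
  classical
  obtain ⟨E, N, h, hs, -, F, hF, hFk⟩ := hG
  let e : V ≃ Fin n := Fintype.equivFinOfCardEq hc
  let f := e.symm
  have hinj := f.injective
  have sE := h.symE
  have sN := h.symN
  let T : Trigraph (Fin n) :=
    { black := { Adj := fun x y => E (f x) (f y) ∧ ¬ N (f x) (f y)
                 symm := ⟨fun x y hh => ⟨sE _ _ hh.1, fun q => hh.2 (sN _ _ q)⟩⟩
                 loopless := ⟨fun x hh => h.irE _ hh.1⟩ }
      gray := { Adj := fun x y => E (f x) (f y) ∧ N (f x) (f y)
                symm := ⟨fun x y hh => ⟨sE _ _ hh.1, sN _ _ hh.2⟩⟩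
                loopless := ⟨fun x hh => h.irE _ hh.1⟩ }
      disjoint := fun u v hh => hh.1.2 hh.2.2 }
  have hE : eE T = fun x y => E (f x) (f y) := by
    ext x y; simp only [eE, T]; tauto
  have hN : nN T = fun x y => N (f x) (f y) := by
    ext x y
    simp only [nN, T]
    constructor
    · rintro ⟨h1, h2⟩
      have := h.tot (f x) (f y) (fun q => h1 (hinj q))
      tauto
    · intro hh
      exact ⟨by rintro rfl; exact h.irN _ hh, fun q => q.2 hh⟩
  refine ⟨T, (indsat_iff T).2 ?_, ?_⟩
  · rw [hE, hN]
    refine ⟨⟨fun x y => sE _ _, fun x y => sN _ _, fun x => h.irE _, fun x => h.irN _,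
      fun x y hxy => h.tot _ _ (fun q => hxy (hinj q)), fun a b c d => h.noP _ _ _ _⟩, ?_⟩
    intro u _ v _ huv hg
    obtain ⟨a, _, b, _, c, _, d, _, hp⟩ :=
      hs (f u) (by simp) (f v) (by simp) (fun q => huv (hinj q)) hg
    refine ⟨e a, by simp, e b, by simp, e c, by simp, e d, by simp, ?_⟩
    have key : ∀ R : V → V → Prop, ∀ x y, Fl R (f u) (f v) x y →
        Fl (fun x y => R (f x) (f y)) u v (e x) (e y) := by
      intro R x y hh
      simpa [Fl, f, Equiv.eq_symm_apply] using hh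
    obtain ⟨p1, p2, p3, p4, p5, p6⟩ := hp
    exact ⟨key _ _ _ p1, key _ _ _ p2, key _ _ _ p3, key _ _ _ p4, key _ _ _ p5, key _ _ _ p6⟩
  · have : T.gray.edgeSet ⊆ ((F.image (Sym2.map e) : Finset (Sym2 (Fin n))) : Set (Sym2 (Fin n))) := by
      intro p
      induction p using Sym2.ind with
      | _ x y =>
      intro hp
      have hp' : E (f x) (f y) ∧ N (f x) (f y) := hp
      rw [Finset.mem_coe, Finset.mem_image]
      exact ⟨s(f x, f y), hF _ _ hp'.1 hp'.2, by simp [f]⟩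
    calc _ ≤ _ := Set.ncard_le_ncard this (Finset.finite_toSet _)
      _ = _ := Set.ncard_coe_finset _
      _ ≤ _ := Finset.card_image_le
      _ ≤ k := hFk

theorem upper (n : ℕ) (hn : 4 ≤ n) : ∃ T : Trigraph (Fin n),
    Trigraph.IsIndSat (SimpleGraph.pathGraph 4) T ∧ T.gray.edgeSet.ncard ≤ (n + 1 + 2) / 3 := by
  have : ∃ j t, 1 ≤ j ∧ 2 * j + 3 * t = n ∧ j + t ≤ (n + 1 + 2) / 3 := by
    have h3 : n % 3 = 0 ∨ n % 3 = 1 ∨ n % 3 = 2 := by omega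
    rcases h3 with h | h | h
    · exact ⟨3, (n - 6) / 3, by omega, by omega, by omega⟩
    · exact ⟨2, (n - 4) / 3, by omega, by omega, by omega⟩
    · exact ⟨1, (n - 2) / 3, by omega, by omega, by omega⟩
  obtain ⟨j, t, hj, hjt, hk⟩ := this
  obtain ⟨V, _, _, hc, hg⟩ := good_iter j t hj
  obtain ⟨T, h1, h2⟩ := good_fin hg (hc.trans hjt)
  exact ⟨T, h1, h2.trans hk⟩

end IndSatP4

/-- For all `n ≥ 4`, `indsat(n, P_4) = ⌈(n+1)/3⌉`. -/
theorem indsat_pathGraph_four (n : ℕ) (hn : 4 ≤ n) :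
    Trigraph.indsat n (SimpleGraph.pathGraph 4) = (((n + 1 + 2) / 3 : ℕ) : ℕ∞) := by
  unfold Trigraph.indsat
  apply le_antisymm
  · obtain ⟨T, h1, h2⟩ := IndSatP4.upper n hn
    exact le_trans (sInf_le ⟨T, h1, rfl⟩) (by exact_mod_cast h2)
  · apply le_sInf
    rintro k ⟨T, hT, rfl⟩
    have := IndSatP4.lower_T T hT (by rw [Fintype.card_fin]; omega)
    rw [Fintype.card_fin] at this
    have h2 : (n + 1 + 2) / 3 ≤ T.gray.edgeSet.ncard := by omega
    exact_mod_cast h2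
end

section
/- For every integer n ≥ 2, every P_4-induced-saturated trigraph on n vertices has at least ⌈(n+1)/3⌉ gray edges; hence indsat(n, P_4) ≥ ⌈(n+1)/3⌉. -/
open SimpleGraph

namespace IndSatAux

structure Tri {V : Type*} (P Q : V → V → Prop) : Prop where
  ps : ∀ a b, P a b → P b a
  qs : ∀ a b, Q a b → Q b a
  pi : ∀ a, ¬ P a a
  qi : ∀ a, ¬ Q a a
  tot : ∀ a b, a ≠ b → P a b ∨ Q a b

theorem Tri.swap {V : Type*} {P Q : V → V → Prop} (h : Tri P Q) : Tri Q P :=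
  ⟨h.qs, h.ps, h.qi, h.pi, fun a b hab => (h.tot a b hab).symm⟩

def P4 {V : Type*} (P Q : V → V → Prop) (a b c d : V) : Prop :=
  P a b ∧ P b c ∧ P c d ∧ Q a c ∧ Q b d ∧ Q a d

def fl {V : Type*} (P : V → V → Prop) (x y : V) (a b : V) : Prop :=
  P a b ∨ (a = x ∧ b = y) ∨ (a = y ∧ b = x)

def NoP4 {V : Type*} (P Q : V → V → Prop) (S : Finset V) : Prop :=
  ∀ a ∈ S, ∀ b ∈ S, ∀ c ∈ S, ∀ d ∈ S, ¬ P4 P Q a b c d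

def Sat {V : Type*} (P Q : V → V → Prop) (S : Finset V) : Prop :=
  NoP4 P Q S ∧ ∀ x ∈ S, ∀ y ∈ S, x ≠ y → ¬ (P x y ∧ Q x y) →
    ∃ a ∈ S, ∃ b ∈ S, ∃ c ∈ S, ∃ d ∈ S, P4 (fl P x y) (fl Q x y) a b c d

theorem P4.rot {V : Type*} {P Q : V → V → Prop} (hp : ∀ a b, P a b → P b a)
    (hq : ∀ a b, Q a b → Q b a) {a b c d : V}
    (h : P4 P Q a b c d) : P4 Q P b d a c := by
  obtain ⟨h1, h2, h3, h4, h5, h6⟩ := h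
  exact ⟨h5, hq _ _ h6, h4, hp _ _ h1, hp _ _ h3, h2⟩

theorem NoP4.swap {V : Type*} {P Q : V → V → Prop} (hT : Tri P Q) {S : Finset V}
    (h : NoP4 P Q S) : NoP4 Q P S := by
  intro a ha b hb c hc d hd h4
  exact h _ hb _ hd _ ha _ hc (h4.rot hT.qs hT.ps)

theorem fl_symm {V : Type*} {P : V → V → Prop} (h : ∀ a b, P a b → P b a) (x y a b : V)
    (h' : fl P x y a b) : fl P x y b a := by
  unfold fl at *
  have := h a b
  tauto

theorem Sat.swap {V : Type*} {P Q : V → V → Prop} (hT : Tri P Q) {S : Finset V}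
    (h : Sat P Q S) : Sat Q P S := by
  refine ⟨h.1.swap hT, ?_⟩
  intro x hx y hy hxy hn
  obtain ⟨a, ha, b, hb, c, hc, d, hd, h4⟩ := h.2 x hx y hy hxy (by tauto)
  exact ⟨b, hb, d, hd, a, ha, c, hc, h4.rot (fl_symm hT.ps x y) (fl_symm hT.qs x y)⟩

theorem NoP4.mono {V : Type*} {P Q : V → V → Prop} {S S' : Finset V}
    (h : NoP4 P Q S) (hs : S' ⊆ S) : NoP4 P Q S' :=
  fun a ha b hb c hc d hd => h a (hs ha) b (hs hb) c (hs hc) d (hs hd)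

/-- white (no `P`) partition -/
def Sep {V : Type*} [DecidableEq V] (P : V → V → Prop) (S : Finset V) : Prop :=
  ∃ X Y : Finset V, X.Nonempty ∧ Y.Nonempty ∧ Disjoint X Y ∧ X ∪ Y = S ∧
    ∀ x ∈ X, ∀ y ∈ Y, ¬ P x y

def UV {V : Type*} (P Q : V → V → Prop) (S : Finset V) : Prop :=
  ∃ u ∈ S, ∃ v ∈ S, u ≠ v ∧ P u v ∧ Q u v ∧ (∀ y ∈ S, y ≠ u → Q u y) ∧
    (∀ y ∈ S, y ≠ v → P v y)

theorem UV.swap {V : Type*} {P Q : V → V → Prop} (hT : Tri P Q) {S : Finset V}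
    (h : UV P Q S) : UV Q P S := by
  obtain ⟨u, hu, v, hv, h1, h2, h3, h4, h5⟩ := h
  exact ⟨v, hv, u, hu, h1.symm, hT.qs _ _ h3, hT.ps _ _ h2, h5, h4⟩

section
variable {V : Type*} [DecidableEq V]

theorem sep_of_subset {P : V → V → Prop} {S X : Finset V} (hX : X ⊆ S) (hne : X.Nonempty)
    (hne' : ∃ y ∈ S, y ∉ X) (h : ∀ x ∈ X, ∀ y ∈ S, y ∉ X → ¬ P x y) : Sep P S := by
  obtain ⟨y, hy, hy'⟩ := hne'
  refine ⟨X, S \ X, hne, ⟨y, by simp [hy, hy']⟩, Finset.disjoint_sdiff,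
    Finset.union_sdiff_of_subset hX, ?_⟩
  intro x hx y hy
  simp only [Finset.mem_sdiff] at hy
  exact h x hx y hy.1 hy.2

theorem struct_sep {P Q : V → V → Prop} (hT : Tri P Q) {S : Finset V} {x : V} (hx : x ∉ S)
    (hN : NoP4 P Q (insert x S)) (h : Sep P S) :
    Sep P (insert x S) ∨ Sep Q (insert x S) ∨ UV P Q (insert x S) := by
  classical
  obtain ⟨X, Y, hXn, hYn, hd, rfl, hXY⟩ := h
  have hd' := Finset.disjoint_left.1 hd
  by_cases hcX : ∃ c ∈ X, P x c
  swap
  · left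
    push Not at hcX
    refine sep_of_subset (X := X) (by intro; simp; tauto) hXn ⟨x, by simp, by simp_all⟩ ?_
    intro a ha b hb hbX hp
    have := hT.ps _ _ hp
    simp only [Finset.mem_insert, Finset.mem_union] at hb
    rcases hb with rfl | hb | hb
    · exact hcX _ ha this
    · exact hbX hb
    · exact hXY _ ha _ hb hp
  by_cases hcY : ∃ c ∈ Y, P x c
  swap
  · left
    push Not at hcY
    refine sep_of_subset (X := Y) (by intro; simp; tauto) hYn ⟨x, by simp, by simp_all⟩ ?_
    intro a ha b hb hbX hp
    have := hT.ps _ _ hp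
    simp only [Finset.mem_insert, Finset.mem_union] at hb
    rcases hb with rfl | hb | hb
    · exact hcY _ ha this
    · exact hXY _ hb _ ha this
    · exact hbX hb
  obtain ⟨cX, hcX, hpX⟩ := hcX
  obtain ⟨cY, hcY, hpY⟩ := hcY
  have hsep : ∀ a ∈ X, ∀ b ∈ Y, Q a b := by
    intro a ha b hb
    refine (hT.tot a b ?_).resolve_left (hXY a ha b hb)
    rintro rfl
    exact hd' ha hb
  have key : ∀ a ∈ X ∪ Y, ∀ b ∈ X ∪ Y, P a b → P x a → ¬ Q x b := by
    intro a ha b hb hab hxa hxb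
    simp only [Finset.mem_union] at ha hb
    rcases ha with ha | ha <;> rcases hb with hb | hb
    · exact hN b (by simp [hb]) a (by simp [ha]) x (by simp) cY (by simp [hcY])
        ⟨hT.ps _ _ hab, hT.ps _ _ hxa, hpY, hT.qs _ _ hxb, hsep _ ha _ hcY, hsep _ hb _ hcY⟩
    · exact hXY _ ha _ hb hab
    · exact hXY _ hb _ ha (hT.ps _ _ hab)
    · exact hN b (by simp [hb]) a (by simp [ha]) x (by simp) cX (by simp [hcX])
        ⟨hT.ps _ _ hab, hT.ps _ _ hxa, hpX, hT.qs _ _ hxb, hT.qs _ _ (hsep _ hcX _ ha),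
          hT.qs _ _ (hsep _ hcX _ hb)⟩
  have hxne : ∀ a ∈ X ∪ Y, x ≠ a := by rintro a ha rfl; exact hx ha
  by_cases hW : ∃ s ∈ X ∪ Y, ¬ P x s
  · left
    obtain ⟨s, hs, hs'⟩ := hW
    refine sep_of_subset (X := (X ∪ Y).filter (fun s => ¬ P x s)) ?_ ⟨s, by simp_all⟩
      ⟨x, by simp, by simp_all⟩ ?_
    · intro a; simp; tauto
    · intro a ha b hb hb' hp
      rw [Finset.mem_filter] at ha hb'
      rcases Finset.mem_insert.1 hb with rfl | hb
      · exact ha.2 (hT.ps _ _ hp)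
      · have hxb : P x b := by by_contra h; exact hb' ⟨hb, h⟩
        exact key b hb a ha.1 (hT.ps _ _ hp) hxb
          ((hT.tot x a (hxne a ha.1)).resolve_left ha.2)
  · push Not at hW
    right
    by_cases hG : ∃ b ∈ X ∪ Y, Q x b
    · right
      obtain ⟨b, hb, hxb⟩ := hG
      refine ⟨b, by simp only [Finset.mem_insert]; right; exact hb, x, by simp, (hxne b hb).symm,
        hT.ps _ _ (hW b hb), hT.qs _ _ hxb, ?_, ?_⟩
      · intro y hy hyb
        rcases Finset.mem_insert.1 hy with rfl | hy
        · exact hT.qs _ _ hxb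
        · refine (hT.tot b y hyb.symm).resolve_left ?_
          intro hp
          exact key y hy b hb (hT.ps _ _ hp) (hW y hy) hxb
      · intro y hy hyx
        exact hW y ((Finset.mem_insert.1 hy).resolve_left hyx)
    · left
      push Not at hG
      refine sep_of_subset (X := {x}) (by simp) (by simp)
        ⟨cX, by simp [hcX], by simpa using (hxne cX (by simp [hcX])).symm⟩ ?_
      intro a ha b hb hb'
      rw [Finset.mem_singleton] at ha hb'
      subst ha
      exact hG b ((Finset.mem_insert.1 hb).resolve_left hb')

theorem struct_uv_aux {P Q : V → V → Prop} (hT : Tri P Q) {S : Finset V} {x : V} (hx : x ∉ S)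
    (hN : NoP4 P Q (insert x S)) {u v : V} (hu : u ∈ S) (hv : v ∈ S) (huv : u ≠ v)
    (hp : P u v) (hq : Q u v) (h1 : ∀ y ∈ S, y ≠ u → Q u y) (h2 : ∀ y ∈ S, y ≠ v → P v y)
    (hxu : ¬ Q x u) : Sep Q (insert x S) ∨ UV P Q (insert x S) := by
  have hxu' : x ≠ u := by rintro rfl; exact hx hu
  have hxv' : x ≠ v := by rintro rfl; exact hx hv
  have hPxu := (hT.tot x u hxu').resolve_right hxu
  by_cases hxv : Q x v
  · right
    have hno : ∀ y ∈ S, y = u ∨ y = v := by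
      intro y hy
      by_contra hc
      push Not at hc
      have hxy : x ≠ y := by rintro rfl; exact hx hy
      by_cases hxyp : P x y
      · exact hN u (by simp [hu]) x (by simp) y (by simp [hy]) v (by simp [hv])
          ⟨hT.ps _ _ hPxu, hxyp, hT.ps _ _ (h2 y hy hc.2), h1 y hy hc.1, hxv, hq⟩
      · have hxyq := (hT.tot x y hxy).resolve_left hxyp
        exact hN x (by simp) u (by simp [hu]) v (by simp [hv]) y (by simp [hy])
          ⟨hPxu, hp, h2 y hy hc.2, hxv, h1 y hy hc.1, hxyq⟩
    refine ⟨v, by simp [hv], u, by simp [hu], huv.symm, hT.ps _ _ hp, hT.qs _ _ hq, ?_, ?_⟩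
    · intro y hy hyv
      rcases Finset.mem_insert.1 hy with rfl | hy
      · exact hT.qs _ _ hxv
      · rcases hno y hy with rfl | rfl
        · exact hT.qs _ _ hq
        · exact absurd rfl hyv
    · intro y hy hyv
      rcases Finset.mem_insert.1 hy with rfl | hy
      · exact hT.ps _ _ hPxu
      · rcases hno y hy with rfl | rfl
        · exact absurd rfl hyv
        · exact hp
  · left
    have hPxv := (hT.tot x v hxv').resolve_right hxv
    refine sep_of_subset (X := {x}) (by simp) (by simp) ⟨u, by simp [hu], by simpa using hxu'.symm⟩ ?_
    intro a ha y hy hy'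
    rw [Finset.mem_singleton] at ha hy'
    subst ha
    have hy := (Finset.mem_insert.1 hy).resolve_left hy'
    intro hxy
    by_cases hyu : y = u
    · subst hyu; exact hxu hxy
    by_cases hyv : y = v
    · subst hyv; exact hxv hxy
    exact hN u (by simp [hu]) a (by simp) v (by simp [hv]) y (by simp [hy])
      ⟨hT.ps _ _ hPxu, hPxv, h2 y hy hyv, hq, hxy, h1 y hy hyu⟩

theorem struct {P Q : V → V → Prop} (hT : Tri P Q) (S : Finset V) (hS : 2 ≤ S.card)
    (hN : NoP4 P Q S) : Sep P S ∨ Sep Q S ∨ UV P Q S := by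
  induction S using Finset.induction_on with
  | empty => simp at hS
  | insert x S hx ih =>
    by_cases hc : 2 ≤ S.card
    · have hN' := hN.mono (Finset.subset_insert x S)
      rcases ih hc hN' with h | h | h
      · exact struct_sep hT hx hN h
      · rcases struct_sep hT.swap hx (hN.swap hT) h with h | h | h
        · exact Or.inr (Or.inl h)
        · exact Or.inl h
        · exact Or.inr (Or.inr (h.swap hT.swap))
      · obtain ⟨u, hu, v, hv, huv, hp, hq, h1, h2⟩ := h
        by_cases hxu : Q x u
        · by_cases hxv : P x v
          · right; right
            refine ⟨u, by simp [hu], v, by simp [hv], huv, hp, hq, ?_, ?_⟩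
            · intro y hy hyu
              rcases Finset.mem_insert.1 hy with rfl | hy
              · exact hT.qs _ _ hxu
              · exact h1 y hy hyu
            · intro y hy hyu
              rcases Finset.mem_insert.1 hy with rfl | hy
              · exact hT.ps _ _ hxv
              · exact h2 y hy hyu
          · rcases struct_uv_aux hT.swap hx (hN.swap hT) hv hu huv.symm (hT.qs _ _ hq)
              (hT.ps _ _ hp) h2 h1 hxv with h | h
            · exact Or.inl h
            · exact Or.inr (Or.inr (h.swap hT.swap))
        · exact Or.inr (struct_uv_aux hT hx hN hu hv huv hp hq h1 h2 hxu)
    · have h1 : S.card = 1 := by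
        rw [Finset.card_insert_of_notMem hx] at hS; omega
      obtain ⟨y, rfl⟩ := Finset.card_eq_one.1 h1
      have hxy : x ≠ y := by simpa using hx
      by_cases hp : P x y
      · by_cases hq : Q x y
        · right; right
          refine ⟨x, by simp, y, by simp, hxy, hp, hq, ?_, ?_⟩
          · intro z hz hzx
            simp [hzx] at hz; subst hz; exact hq
          · intro z hz hzx
            simp [hzx] at hz; subst hz; exact hT.ps _ _ hp
        · right; left
          exact ⟨{x}, {y}, by simp, by simp, by simpa using hxy, rfl, by simpa using hq⟩
      · left
        exact ⟨{x}, {y}, by simp, by simp, by simpa using hxy, rfl, by simpa using hp⟩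

end

open Classical in
noncomputable def g2 {V : Type*} (P Q : V → V → Prop) (S : Finset V) : ℕ :=
  ((S ×ˢ S).filter (fun p => P p.1 p.2 ∧ Q p.1 p.2)).card

theorem g2_swap {V : Type*} (P Q : V → V → Prop) (S : Finset V) : g2 P Q S = g2 Q P S := by
  unfold g2
  congr 1
  ext p
  simp only [Finset.mem_filter]
  tauto

section
variable {V : Type*} [DecidableEq V]

theorem g2_add (P Q : V → V → Prop) {X Y : Finset V} (h : Disjoint X Y) :
    g2 P Q X + g2 P Q Y ≤ g2 P Q (X ∪ Y) := by
  classical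
  unfold g2
  rw [← Finset.card_union_of_disjoint]
  · apply Finset.card_le_card
    intro p
    simp only [Finset.mem_union, Finset.mem_filter, Finset.mem_product]
    tauto
  · rw [Finset.disjoint_left] at h ⊢
    intro p
    simp only [Finset.mem_filter, Finset.mem_product]
    intro h1 h2
    exact h h1.1.1 h2.1.1

theorem g2_star {P Q : V → V → Prop} (hT : Tri P Q) {S A D : Finset V} {u : V} (hu : u ∈ S)
    (hA : A ⊆ S) (hD : D ⊆ S) (hAD : Disjoint A D) (huA : u ∉ A) (huD : u ∉ D)
    (h : ∀ a ∈ A, P u a ∧ Q u a) : 2 * A.card + g2 P Q D ≤ g2 P Q S := by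
  classical
  unfold g2
  have e1 : (A ×ˢ ({u} : Finset V)).card = A.card := by simp
  have e2 : (({u} : Finset V) ×ˢ A).card = A.card := by simp
  have d1 : Disjoint (A ×ˢ ({u} : Finset V)) (({u} : Finset V) ×ˢ A) := by
    rw [Finset.disjoint_left]
    rintro ⟨a, b⟩
    simp only [Finset.mem_product, Finset.mem_singleton]
    rintro ⟨h1, h2⟩ ⟨h3, h4⟩
    subst h3; exact huA h1
  have d2 : Disjoint (A ×ˢ ({u} : Finset V) ∪ ({u} : Finset V) ×ˢ A)
      ((D ×ˢ D).filter (fun p => P p.1 p.2 ∧ Q p.1 p.2)) := by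
    rw [Finset.disjoint_left]
    rintro ⟨a, b⟩
    simp only [Finset.mem_union, Finset.mem_product, Finset.mem_singleton, Finset.mem_filter]
    rintro (⟨h1, h2⟩ | ⟨h1, h2⟩) ⟨⟨h3, h4⟩, _⟩
    · subst h2; exact huD h4
    · subst h1; exact huD h3
  have := Finset.card_union_of_disjoint d2
  rw [Finset.card_union_of_disjoint d1, e1, e2] at this
  rw [two_mul, ← this]
  apply Finset.card_le_card
  rintro ⟨a, b⟩
  simp only [Finset.mem_union, Finset.mem_product, Finset.mem_singleton, Finset.mem_filter]
  rintro ((⟨h1, h2⟩ | ⟨h1, h2⟩) | ⟨⟨h3, h4⟩, h5⟩)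
  · subst h2; exact ⟨⟨hA h1, hu⟩, hT.ps _ _ (h a h1).1, hT.qs _ _ (h a h1).2⟩
  · subst h1; exact ⟨⟨hu, hA h2⟩, h b h2⟩
  · exact ⟨⟨hD h3, hD h4⟩, h5⟩

theorem sat_small {P Q : V → V → Prop} (hT : Tri P Q) {S : Finset V} (hS : S.card ≤ 3)
    (h : Sat P Q S) : ∀ x ∈ S, ∀ y ∈ S, x ≠ y → P x y ∧ Q x y := by
  intro x hx y hy hxy
  by_contra hn
  obtain ⟨a, ha, b, hb, c, hc, d, hd, h4⟩ := h.2 x hx y hy hxy hn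
  have hpi := hT.pi
  have hqi := hT.qi
  have hsub : ({a, b, c, d} : Finset V) ⊆ S := by
    intro z; simp only [Finset.mem_insert, Finset.mem_singleton]; rintro (rfl|rfl|rfl|rfl) <;> assumption
  have hcard : ({a, b, c, d} : Finset V).card = 4 := by
    obtain ⟨h1, h2, h3, h4, h5, h6⟩ := h4
    have : a ≠ b ∧ b ≠ c ∧ c ≠ d ∧ a ≠ c ∧ b ≠ d ∧ a ≠ d := by
      unfold fl at *
      refine ⟨?_, ?_, ?_, ?_, ?_, ?_⟩ <;> rintro rfl <;> simp_all <;> grind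
    rw [Finset.card_eq_of_equiv_fin]
    exact Fintype.equivFinOfCardEq (by simp [this])
  have := Finset.card_le_card hsub
  omega

theorem g2_small {P Q : V → V → Prop} (hT : Tri P Q) {S : Finset V} (hS : S.card ≤ 3)
    (h : Sat P Q S) : S.card * S.card - S.card ≤ g2 P Q S := by
  classical
  rw [← Finset.offDiag_card]
  unfold g2
  apply Finset.card_le_card
  rintro ⟨a, b⟩
  simp only [Finset.mem_offDiag, Finset.mem_filter, Finset.mem_product]
  rintro ⟨h1, h2, h3⟩
  exact ⟨⟨h1, h2⟩, sat_small hT hS h a h1 b h2 h3⟩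

theorem sat_left {P Q : V → V → Prop} (hT : Tri P Q) {X Y : Finset V} (hd : Disjoint X Y)
    (hXY : ∀ x ∈ X, ∀ y ∈ Y, ¬ P x y) (h : Sat P Q (X ∪ Y)) : Sat P Q X := by
  refine ⟨h.1.mono Finset.subset_union_left, ?_⟩
  intro x hx y hy hxy hn
  have hd' := Finset.disjoint_left.1 hd
  obtain ⟨a, ha, b, hb, c, hc, d, hd, h4⟩ := h.2 x (by simp [hx]) y (by simp [hy]) hxy hn
  have key : ∀ p ∈ X ∪ Y, ∀ q ∈ X ∪ Y, fl P x y p q → (p ∈ X ↔ q ∈ X) := by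
    intro p hp q hq hpq
    rw [Finset.mem_union] at hp hq
    rcases hpq with hpq | ⟨rfl, rfl⟩ | ⟨rfl, rfl⟩
    · have := hT.ps _ _ hpq
      have h1 := hXY p
      have h2 := hXY q
      constructor
      · intro hpX; by_contra hqX; exact h1 hpX q (hq.resolve_left hqX) hpq
      · intro hpX; by_contra hqX; exact h2 hpX p (hp.resolve_left hqX) this
    · tauto
    · tauto
  have k1 := key _ ha _ hb h4.1
  have k2 := key _ hb _ hc h4.2.1
  have k3 := key _ hc _ hd h4.2.2.1
  by_cases haX : a ∈ X
  · exact ⟨a, haX, b, k1.1 haX, c, k2.1 (k1.1 haX), d, k3.1 (k2.1 (k1.1 haX)), h4⟩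
  · exfalso
    refine h.1 a ha b hb c hc d hd ?_
    have hne : ∀ p q, p ∉ X → ∀ R : V → V → Prop, fl R x y p q → R p q := by
      intro p q hp R hR
      rcases hR with hR | ⟨rfl, _⟩ | ⟨rfl, _⟩
      · exact hR
      · exact absurd hx hp
      · exact absurd hy hp
    have hbX : b ∉ X := by tauto
    have hcX : c ∉ X := by tauto
    obtain ⟨h1, h2, h3, h4, h5, h6⟩ := h4
    exact ⟨hne _ _ haX _ h1, hne _ _ hbX _ h2, hne _ _ hcX _ h3, hne _ _ haX _ h4,
      hne _ _ hbX _ h5, hne _ _ haX _ h6⟩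

theorem sat_right {P Q : V → V → Prop} (hT : Tri P Q) {X Y : Finset V} (hd : Disjoint X Y)
    (hXY : ∀ x ∈ X, ∀ y ∈ Y, ¬ P x y) (h : Sat P Q (X ∪ Y)) : Sat P Q Y := by
  refine sat_left hT hd.symm (fun y hy x hx hp => hXY x hx y hy (hT.ps _ _ hp)) ?_
  rwa [Finset.union_comm]

/-- The key fact about the `u,v` configuration. -/
theorem uv_key {P Q : V → V → Prop} (hT : Tri P Q) {S : Finset V} (hN : NoP4 P Q S) {u v a : V}
    (hu : u ∈ S) (hv : v ∈ S) (hq : Q u v)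
    (h1 : ∀ y ∈ S, y ≠ u → Q u y) (h2 : ∀ y ∈ S, y ≠ v → P v y)
    (ha : a ∈ S) (hav : a ≠ v) (hua : P u a) (y : V) (hy : y ∈ S) (hyu : y ≠ u) (hyv : y ≠ v) :
    ¬ Q a y := by
  intro hay
  exact hN u hu a ha v hv y hy ⟨hua, hT.ps _ _ (h2 a ha hav), h2 y hy hyv, hq, hay, h1 y hy hyu⟩

def Bound (P Q : V → V → Prop) (S : Finset V) : Prop := 2 * S.card + 2 ≤ 3 * g2 P Q S

def IH (P Q : V → V → Prop) (S : Finset V) : Prop :=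
  ∀ D ⊂ S, 2 ≤ D.card → Sat P Q D → Bound P Q D

theorem uv_half {P Q : V → V → Prop} (hT : Tri P Q) {S : Finset V} (hS : Sat P Q S)
    (ih : IH P Q S) (hc : 4 ≤ S.card) {u v : V} (hu : u ∈ S) (hv : v ∈ S) (huv : u ≠ v)
    (hp : P u v) (hq : Q u v) (h1 : ∀ y ∈ S, y ≠ u → Q u y) (h2 : ∀ y ∈ S, y ≠ v → P v y)
    (hC : ∀ y ∈ S, y ≠ u → y ≠ v → ¬ Q v y) : 2 * S.card + 4 ≤ 3 * g2 P Q S := by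
  classical
  set A := S.filter (fun y => P u y) with hA
  set D := S.filter (fun y => ¬ P u y ∧ y ≠ u) with hD
  have hAS : A ⊆ S := Finset.filter_subset _ _
  have hDS : D ⊆ S := Finset.filter_subset _ _
  have huA : u ∉ A := by simp [hA, hT.pi]
  have huD : u ∉ D := by simp [hD]
  have hAD : Disjoint A D := by
    rw [Finset.disjoint_left]; simp only [hA, hD, Finset.mem_filter]; tauto
  have hvA : v ∈ A := by simp [hA, hv, hp]
  have hun : S = insert u (A ∪ D) := by
    ext z
    simp only [hA, hD, Finset.mem_insert, Finset.mem_union, Finset.mem_filter]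
    by_cases hz : z = u
    · subst hz; simp [hu]
    · tauto
  have hcard : S.card = A.card + D.card + 1 := by
    conv_lhs => rw [hun]
    rw [Finset.card_insert_of_notMem (by simp [huA, huD]), Finset.card_union_of_disjoint hAD]
  have hAne : ∀ a ∈ A, a ≠ u := by rintro a ha rfl; exact huA ha
  have hg := g2_star hT hu hAS hDS hAD huA huD (fun a ha =>
    ⟨(Finset.mem_filter.1 ha).2, h1 a (hAS ha) (hAne a ha)⟩)
  have hdom : ∀ a ∈ A, ∀ y ∈ S, y ≠ u → ¬ Q a y := by
    intro a ha y hy hyu hay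
    by_cases hav : a = v
    · subst hav
      by_cases hya : y = a
      · subst hya; exact hT.qi _ hay
      · exact hC y hy hyu hya hay
    · by_cases hyv : y = v
      · subst hyv
        exact hC a (hAS ha) (hAne a ha) hav (hT.qs _ _ hay)
      · exact uv_key hT hS.1 hu hv hq h1 h2 (hAS ha) hav (Finset.mem_filter.1 ha).2 y hy hyu hyv hay
  have hApos : 1 ≤ A.card := Finset.card_pos.2 ⟨v, hvA⟩
  by_cases hD2 : 2 ≤ D.card
  · have hsat : Sat P Q D := by
      refine ⟨hS.1.mono hDS, ?_⟩
      intro x hx y hy hxy hn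
      obtain ⟨a, ha, b, hb, c, hc, d, hd, h4⟩ := hS.2 x (hDS hx) y (hDS hy) hxy hn
      have hadd : ∀ p, p ∉ D → ∀ q, ∀ R : V → V → Prop, (fl R x y p q → R p q) ∧
          (fl R x y q p → R q p) := by
        intro p hp q R
        have hpx : p ≠ x := by rintro rfl; exact hp hx
        have hpy : p ≠ y := by rintro rfl; exact hp hy
        unfold fl
        tauto
      have hAu : ∀ p ∈ A, ∀ q ∈ S, (fl Q x y p q ∨ fl Q x y q p) → q = u := by
        intro p hp q hq h
        have hpD : p ∉ D := Finset.disjoint_left.1 hAD hp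
        by_contra hqu
        refine hdom p hp q hq hqu ?_
        rcases h with h | h
        · exact (hadd p hpD q Q).1 h
        · exact hT.qs _ _ ((hadd p hpD q Q).2 h)
      have huP : ∀ q ∈ S, (fl P x y u q ∨ fl P x y q u) → q ∈ A := by
        intro q hq h
        refine Finset.mem_filter.2 ⟨hq, ?_⟩
        rcases h with h | h
        · exact (hadd u huD q P).1 h
        · exact hT.ps _ _ ((hadd u huD q P).2 h)
      have hcases : ∀ q ∈ S, q = u ∨ q ∈ A ∨ q ∈ D := by
        intro q hq
        rw [hun] at hq
        simpa using hq
      obtain ⟨e1, e2, e3, e4, e5, e6⟩ := h4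
      have nA : a ∉ A := by
        intro h
        have i1 := hAu a h c hc (Or.inl e4)
        have i2 := hAu a h d hd (Or.inl e6)
        subst i1; subst i2
        exact huA (huP _ hc (Or.inl e3))
      have nD : d ∉ A := by
        intro h
        have i1 := hAu d h b hb (Or.inr e5)
        have i2 := hAu d h a ha (Or.inr e6)
        subst i1; subst i2
        exact huA (huP _ hb (Or.inl e1))
      have nB : b ∉ A := by
        intro h
        have i1 := hAu b h d hd (Or.inl e5)
        subst i1
        have i2 := hAu c (huP _ hc (Or.inr e3)) a ha (Or.inr e4)
        subst i2
        exact hT.qi _ ((hadd a huD a Q).1 e6)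
      have nC : c ∉ A := by
        intro h
        have i1 := hAu c h a ha (Or.inr e4)
        subst i1
        exact nB (huP _ hb (Or.inl e1))
      have ua : a ≠ u := by rintro rfl; exact nB (huP _ hb (Or.inl e1))
      have ub : b ≠ u := by rintro rfl; exact nA (huP _ ha (Or.inr e1))
      have uc : c ≠ u := by rintro rfl; exact nB (huP _ hb (Or.inr e2))
      have ud : d ≠ u := by rintro rfl; exact nC (huP _ hc (Or.inr e3))
      exact ⟨a, ((hcases a ha).resolve_left ua).resolve_left nA,
        b, ((hcases b hb).resolve_left ub).resolve_left nB,
        c, ((hcases c hc).resolve_left uc).resolve_left nC,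
        d, ((hcases d hd).resolve_left ud).resolve_left nD, e1, e2, e3, e4, e5, e6⟩
    have := ih D ⟨hDS, fun h => huD (h hu)⟩ hD2 hsat
    unfold Bound at this
    omega
  · omega

theorem uv_bound {P Q : V → V → Prop} (hT : Tri P Q) {S : Finset V} (hS : Sat P Q S)
    (ih : IH P Q S) (ih' : IH Q P S) (hc : 4 ≤ S.card) (h : UV P Q S) :
    2 * S.card + 4 ≤ 3 * g2 P Q S := by
  obtain ⟨u, hu, v, hv, huv, hp, hq, h1, h2⟩ := h
  by_cases hC : ∀ y ∈ S, y ≠ u → y ≠ v → ¬ Q v y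
  · exact uv_half hT hS ih hc hu hv huv hp hq h1 h2 hC
  by_cases hA : ∀ y ∈ S, y ≠ v → y ≠ u → ¬ P u y
  · rw [g2_swap]
    exact uv_half hT.swap (hS.swap hT) ih' hc hv hu huv.symm (hT.qs _ _ hq) (hT.ps _ _ hp) h2 h1 hA
  exfalso
  push Not at hC hA
  obtain ⟨c, hcS, hcu, hcv, hvc⟩ := hC
  obtain ⟨a, haS, hav, hau, hua⟩ := hA
  have ka := uv_key hT hS.1 hu hv hq h1 h2 haS hav hua
  have kc := uv_key hT.swap (hS.swap hT).1 hv hu (hT.ps _ _ hp) h2 h1 hcS hcu hvc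
  by_cases hac : a = c
  · subst hac
    have : ∃ y ∈ S, y ∉ ({u, v, a} : Finset V) := by
      by_contra hno
      push Not at hno
      have h3 := Finset.card_le_card (show S ⊆ {u, v, a} from hno)
      have := Finset.card_le_three (a := u) (b := v) (c := a)
      omega
    obtain ⟨y, hy, hy'⟩ := this
    simp only [Finset.mem_insert, Finset.mem_singleton, not_or] at hy'
    rcases hT.tot a y (Ne.symm hy'.2.2) with h | h
    · exact kc y hy hy'.2.1 hy'.1 h
    · exact ka y hy hy'.1 hy'.2.1 h
  · rcases hT.tot a c hac with h | h
    · exact kc a haS hav hau (hT.ps _ _ h)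
    · exact ka c hcS hcu hcv h

theorem single_step {P Q : V → V → Prop} (hT : Tri P Q) {x : V} {Y : Finset V} (hx : x ∉ Y)
    (hS : Sat P Q (insert x Y)) (hxY : ∀ y ∈ Y, ¬ P x y)
    (ih : IH P Q (insert x Y)) (ih' : IH Q P (insert x Y)) (hc : 3 ≤ Y.card) :
    Bound P Q (insert x Y) := by
  have hdj : Disjoint {x} Y := by simpa using hx
  have hSY : Sat P Q Y := sat_right hT hdj (by simpa using hxY) hS
  have hcard := Finset.card_insert_of_notMem hx
  have hg := g2_add P Q hdj
  change g2 P Q {x} + g2 P Q Y ≤ g2 P Q (insert x Y) at hg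
  have hYS : Y ⊂ insert x Y := Finset.ssubset_insert hx
  unfold Bound
  rw [hcard]
  suffices 2 * Y.card + 4 ≤ 3 * g2 P Q Y by omega
  by_cases h3 : Y.card = 3
  · have := g2_small hT h3.le hSY
    rw [h3] at this ⊢
    omega
  -- flipping `x y` must create a `P4`, which gives `y` neighbour/non-neighbour
  have hflip : ∀ y ∈ Y, (∃ z ∈ Y, z ≠ y ∧ P y z) ∧ (∃ z ∈ Y, z ≠ y ∧ Q y z) := by
    intro y hy
    have hxy : x ≠ y := by rintro rfl; exact hx hy
    have hyx := hxY y hy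
    obtain ⟨a, ha, b, hb, c, hc, d, hd, h4⟩ := hS.2 x (by simp) y (by simp [hy]) hxy (by tauto)
    have hpx : ∀ z ∈ insert x Y, (fl P x y x z ∨ fl P x y z x) → z = y := by
      intro z hz h
      have hpi := hT.pi x
      have : z ∈ Y → ¬ P x z := hxY z
      have := hT.ps z x
      rw [Finset.mem_insert] at hz
      unfold fl at h
      by_contra hzy
      rcases hz with rfl | hz
      · tauto
      · tauto
    have hirr : ∀ R : V → V → Prop, (∀ z, ¬ R z z) → ∀ z, ¬ fl R x y z z := by
      intro R hR z hz
      rcases hz with hz | ⟨rfl, h⟩ | ⟨rfl, h⟩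
      · exact hR _ hz
      · exact hxy h
      · exact hxy h.symm
    have hfl : ∀ R : V → V → Prop, ∀ p q, p ≠ x → q ≠ x → fl R x y p q → R p q := by
      intro R p q hp hq h
      unfold fl at h
      tauto
    have iP := hirr P hT.pi
    have iQ := hirr Q hT.qi
    obtain ⟨e1, e2, e3, e4, e5, e6⟩ := h4
    have bx : b ≠ x := by
      rintro rfl
      have i1 := hpx a ha (Or.inr e1)
      have i2 := hpx c hc (Or.inl e2)
      subst i1; subst i2; exact iQ _ e4
    have cx : c ≠ x := by
      rintro rfl
      have i1 := hpx b hb (Or.inr e2)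
      have i2 := hpx d hd (Or.inl e3)
      subst i1; subst i2; exact iQ _ e5
    have bY := (Finset.mem_insert.1 hb).resolve_left bx
    have cY := (Finset.mem_insert.1 hc).resolve_left cx
    by_cases ax : a = x
    · subst ax
      have hby := hpx b hb (Or.inl e1)
      subst hby
      have dx : d ≠ a := by rintro rfl; exact iQ _ e6
      have dY := (Finset.mem_insert.1 hd).resolve_left dx
      refine ⟨⟨c, cY, ?_, hfl P _ _ bx cx e2⟩, ⟨d, dY, ?_, hfl Q _ _ bx dx e5⟩⟩
      · rintro rfl; exact iP _ e2
      · rintro rfl; exact iQ _ e5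
    · have aY := (Finset.mem_insert.1 ha).resolve_left ax
      by_cases dx : d = x
      · subst dx
        have hcy := hpx c hc (Or.inr e3)
        subst hcy
        refine ⟨⟨b, bY, ?_, hT.ps _ _ (hfl P _ _ bx cx e2)⟩,
          ⟨a, aY, ?_, hT.qs _ _ (hfl Q _ _ ax cx e4)⟩⟩
        · rintro rfl; exact iP _ e2
        · rintro rfl; exact iQ _ e4
      · exfalso
        exact hS.1 a ha b hb c hc d hd ⟨hfl P _ _ ax bx e1, hfl P _ _ bx cx e2,
          hfl P _ _ cx dx e3, hfl Q _ _ ax cx e4, hfl Q _ _ bx dx e5, hfl Q _ _ ax dx e6⟩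
  have ihY : IH P Q Y := fun D hD => ih D (hD.trans hYS)
  have ihY' : IH Q P Y := fun D hD => ih' D (hD.trans hYS)
  have hsep : ∀ P' Q' : V → V → Prop, Tri P' Q' → Sat P' Q' Y → IH P' Q' Y →
      (∀ y ∈ Y, ∃ z ∈ Y, z ≠ y ∧ P' y z) → Sep P' Y → 2 * Y.card + 4 ≤ 3 * g2 P' Q' Y := by
    intro P' Q' hT' hS' ih hz h
    obtain ⟨Y1, Y2, hn1, hn2, hd, rfl, hY⟩ := h
    have hd' := Finset.disjoint_left.1 hd
    have c1 : 2 ≤ Y1.card := by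
      by_contra hlt
      have : Y1.card = 1 := by have := hn1.card_pos; omega
      obtain ⟨y, rfl⟩ := Finset.card_eq_one.1 this
      obtain ⟨z, hz, hzy, hp⟩ := hz y (by simp)
      exact hY y (by simp) z (by simpa [hzy] using hz) hp
    have c2 : 2 ≤ Y2.card := by
      by_contra hlt
      have : Y2.card = 1 := by have := hn2.card_pos; omega
      obtain ⟨y, rfl⟩ := Finset.card_eq_one.1 this
      obtain ⟨z, hz, hzy, hp⟩ := hz y (by simp)
      exact hY z (by simpa [hzy] using hz) y (by simp) (hT'.ps _ _ hp)
    obtain ⟨y1, hy1⟩ := hn1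
    obtain ⟨y2, hy2⟩ := hn2
    have b1 := ih Y1 ⟨Finset.subset_union_left, fun h => hd' (h (by simp [hy2])) hy2⟩ c1
      (sat_left hT' hd hY hS')
    have b2 := ih Y2 ⟨Finset.subset_union_right, fun h => hd' hy1 (h (by simp [hy1]))⟩ c2
      (sat_right hT' hd hY hS')
    have := g2_add P' Q' hd
    rw [Finset.card_union_of_disjoint hd]
    unfold Bound at b1 b2
    omega
  rcases struct hT Y (by omega) hSY.1 with h | h | h
  · exact hsep P Q hT hSY ihY (fun y hy => (hflip y hy).1) h
  · rw [g2_swap]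
    exact hsep Q P hT.swap (hSY.swap hT) ihY' (fun y hy => (hflip y hy).2) h
  · exact uv_bound hT hSY ihY ihY' (by omega) h

theorem sep_step {P Q : V → V → Prop} (hT : Tri P Q) {S : Finset V} (hS : Sat P Q S)
    (ih : IH P Q S) (ih' : IH Q P S) (hc : 4 ≤ S.card) (h : Sep P S) : Bound P Q S := by
  obtain ⟨X, Y, hn1, hn2, hd, rfl, hY⟩ := h
  have hd' := Finset.disjoint_left.1 hd
  have hcard := Finset.card_union_of_disjoint hd
  have p1 := hn1.card_pos
  have p2 := hn2.card_pos
  by_cases c1 : X.card = 1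
  · obtain ⟨x, rfl⟩ := Finset.card_eq_one.1 c1
    exact single_step hT (by simpa using hd) hS (by simpa using hY) ih ih' (by omega)
  by_cases c2 : Y.card = 1
  · obtain ⟨x, rfl⟩ := Finset.card_eq_one.1 c2
    rw [Finset.union_comm] at *
    exact single_step hT (by simpa using hd) hS
      (fun y hy hp => hY y hy x (by simp) (hT.ps _ _ hp)) ih ih' (by omega)
  obtain ⟨y1, hy1⟩ := hn1
  obtain ⟨y2, hy2⟩ := hn2
  have b1 := ih X ⟨Finset.subset_union_left, fun h => hd' (h (by simp [hy2])) hy2⟩ (by omega)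
    (sat_left hT hd hY hS)
  have b2 := ih Y ⟨Finset.subset_union_right, fun h => hd' hy1 (h (by simp [hy1]))⟩ (by omega)
    (sat_right hT hd hY hS)
  have := g2_add P Q hd
  unfold Bound at *
  omega

theorem main (S : Finset V) : ∀ P Q : V → V → Prop, Tri P Q → 2 ≤ S.card → Sat P Q S →
    Bound P Q S := by
  induction S using Finset.strongInduction with
  | H S ih =>
    intro P Q hT h2 hS
    have ih1 : IH P Q S := fun D hD h2 hs => ih D hD P Q hT h2 hs
    have ih2 : IH Q P S := fun D hD h2 hs => ih D hD Q P hT.swap h2 hs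
    by_cases h3 : S.card ≤ 3
    · have := g2_small hT h3 hS
      unfold Bound
      generalize S.card = k at *
      interval_cases k <;> omega
    · rcases struct hT S h2 hS.1 with h | h | h
      · exact sep_step hT hS ih1 ih2 (by omega) h
      · have := sep_step hT.swap (hS.swap hT) ih2 ih1 (by omega) h
        unfold Bound at *
        rwa [g2_swap]
      · have := uv_bound hT hS ih1 ih2 (by omega) h
        unfold Bound
        omega

end

end IndSatAux

namespace IndSatAux

theorem tri_of {V : Type*} (T : Trigraph V) :
    Tri (fun u v => T.black.Adj u v ∨ T.gray.Adj u v) (fun u v => u ≠ v ∧ ¬ T.black.Adj u v) where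
  ps a b h := h.imp (fun h => h.symm) (fun h => h.symm)
  qs a b h := ⟨h.1.symm, fun h' => h.2 h'.symm⟩
  pi a h := by simp at h
  qi a h := h.1 rfl
  tot a b h := by tauto

theorem single_adj {V : Type*} (x y a b : V) :
    (Trigraph.single x y).Adj a b ↔ a ≠ b ∧ ((a = x ∧ b = y) ∨ (a = y ∧ b = x)) := by
  simp [Trigraph.single]
  tauto

theorem realize {V : Type*} (T : Trigraph V) (a b c d : V)
    (h : P4 (fun u v => T.black.Adj u v ∨ T.gray.Adj u v)
      (fun u v => u ≠ v ∧ ¬ T.black.Adj u v) a b c d) :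
    ∃ R, T.IsRealization R ∧ Trigraph.HasInducedCopy (SimpleGraph.pathGraph 4) R := by
  obtain ⟨h1, h2, h3, ⟨n4, h4⟩, ⟨n5, h5⟩, ⟨n6, h6⟩⟩ := h
  have n1 : a ≠ b := by rintro rfl; simp at h1
  have n2 : b ≠ c := by rintro rfl; simp at h2
  have n3 : c ≠ d := by rintro rfl; simp at h3
  let R : SimpleGraph V := T.black ⊔ (T.gray ⊓ SimpleGraph.fromEdgeSet {s(a, b), s(b, c), s(c, d)})
  refine ⟨R, ⟨le_sup_left, sup_le_sup_left inf_le_left _⟩, ?_⟩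
  have r1 : R.Adj a b := by simp [R, n1]; tauto
  have r2 : R.Adj b c := by simp [R, n2]; tauto
  have r3 : R.Adj c d := by simp [R, n3]; tauto
  have r4 : ¬ R.Adj a c := by simp [R, h4]; grind
  have r5 : ¬ R.Adj b d := by simp [R, h5]; grind
  have r6 : ¬ R.Adj a d := by simp [R, h6]; grind
  have s1 := r1.symm
  have s2 := r2.symm
  have s3 := r3.symm
  have s4 : ¬ R.Adj c a := fun h => r4 h.symm
  have s5 : ¬ R.Adj d b := fun h => r5 h.symm
  have s6 : ¬ R.Adj d a := fun h => r6 h.symm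
  clear_value R
  refine ⟨⟨⟨![a, b, c, d], ?_⟩, ?_⟩⟩
  · intro i j hij
    fin_cases i <;> fin_cases j <;> simp_all
  · intro i j
    rw [SimpleGraph.pathGraph_adj]
    change R.Adj (![a, b, c, d] i) (![a, b, c, d] j) ↔ _
    fin_cases i <;> fin_cases j <;> simp [*]

theorem unrealize {V : Type*} (T : Trigraph V) (x y : V) (R : SimpleGraph V)
    (hR : (T.flip x y).IsRealization R) (h : Trigraph.HasInducedCopy (SimpleGraph.pathGraph 4) R) :
    ∃ a b c d, P4 (fl (fun u v => T.black.Adj u v ∨ T.gray.Adj u v) x y)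
      (fl (fun u v => u ≠ v ∧ ¬ T.black.Adj u v) x y) a b c d := by
  obtain ⟨f⟩ := h
  have hP : ∀ a b, R.Adj a b → fl (fun u v => T.black.Adj u v ∨ T.gray.Adj u v) x y a b := by
    intro a b hab
    have := hR.2 hab
    simp only [Trigraph.flip, SimpleGraph.sup_adj, SimpleGraph.sdiff_adj, single_adj] at this
    unfold fl
    tauto
  have hQ : ∀ a b, a ≠ b → ¬ R.Adj a b → fl (fun u v => u ≠ v ∧ ¬ T.black.Adj u v) x y a b := by
    intro a b hne hab
    have : ¬ (T.flip x y).black.Adj a b := fun h => hab (hR.1 h)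
    simp only [Trigraph.flip, SimpleGraph.sdiff_adj, single_adj] at this
    unfold fl
    tauto
  have hf : ∀ i j, R.Adj (f i) (f j) ↔ i.val + 1 = j.val ∨ j.val + 1 = i.val := by
    intro i j
    rw [f.map_adj_iff, SimpleGraph.pathGraph_adj]
  have hi : ∀ i j, i ≠ j → f i ≠ f j := fun i j h h' => h (f.injective h')
  refine ⟨f 0, f 1, f 2, f 3, hP _ _ ?_, hP _ _ ?_, hP _ _ ?_, hQ _ _ (hi _ _ (by decide)) ?_,
    hQ _ _ (hi _ _ (by decide)) ?_, hQ _ _ (hi _ _ (by decide)) ?_⟩ <;> rw [hf] <;> decide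

theorem count {n : ℕ} (T : Trigraph (Fin n)) :
    g2 (fun u v => T.black.Adj u v ∨ T.gray.Adj u v) (fun u v => u ≠ v ∧ ¬ T.black.Adj u v)
      Finset.univ = 2 * T.gray.edgeSet.ncard := by
  classical
  have h : T.gray.edgeSet.ncard = T.gray.edgeFinset.card := by
    rw [← SimpleGraph.coe_edgeFinset, Set.ncard_coe_finset]
  rw [h, SimpleGraph.two_mul_card_edgeFinset]
  unfold g2
  congr 1
  ext ⟨a, b⟩
  simp only [Finset.mem_filter, Finset.mem_product, Finset.mem_univ, true_and]
  have h1 := T.disjoint a b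
  have h2 : T.gray.Adj a b → a ≠ b := fun h => h.ne
  tauto

theorem final (n : ℕ) (hn : 2 ≤ n) (T : Trigraph (Fin n))
    (hT : Trigraph.IsIndSat (SimpleGraph.pathGraph 4) T) :
    (n + 1 + 2) / 3 ≤ T.gray.edgeSet.ncard := by
  have := main Finset.univ _ _ (tri_of T) (by simpa using hn) ?_
  · unfold Bound at this
    rw [count] at this
    simp at this
    omega
  · refine ⟨?_, ?_⟩
    · intro a _ b _ c _ d _ h
      obtain ⟨R, h1, h2⟩ := realize T a b c d h
      exact hT.1 R h1 h2
    · intro x _ y _ hxy hn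
      obtain ⟨R, h1, h2⟩ := hT.2 x y hxy (fun hg => hn ⟨Or.inr hg, hxy, fun hb =>
        T.disjoint x y ⟨hb, hg⟩⟩)
      obtain ⟨a, b, c, d, h⟩ := unrealize T x y R h1 h2
      exact ⟨a, by simp, b, by simp, c, by simp, d, by simp, h⟩

end IndSatAux

/-- For every `n ≥ 2`, every `P_4`-induced-saturated trigraph on `n`
vertices has at least `⌈(n+1)/3⌉` gray edges; hence
`indsat(n, P_4) ≥ ⌈(n+1)/3⌉`. -/
theorem indsat_pathGraph_four_lower (n : ℕ) (hn : 2 ≤ n) :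
    (∀ T : Trigraph (Fin n), Trigraph.IsIndSat (SimpleGraph.pathGraph 4) T →
        (n + 1 + 2) / 3 ≤ T.gray.edgeSet.ncard) ∧
    (((n + 1 + 2) / 3 : ℕ) : ℕ∞) ≤ Trigraph.indsat n (SimpleGraph.pathGraph 4) := by
  refine ⟨fun T hT => IndSatAux.final n hn T hT, ?_⟩
  unfold Trigraph.indsat
  refine le_sInf ?_
  rintro k ⟨T, hT, rfl⟩
  exact_mod_cast IndSatAux.final n hn T hT
end

section
/- For every integer n with n = 5 or n ≥ 7, indsat(n, P_4) < sat(n, P_4), where sat(n, P_4) = k if n = 2k and sat(n, P_4) = k + 1 if n = 2k − 1; i.e., ⌈(n+1)/3⌉ < sat(n, P_4) for these n. -/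
open SimpleGraph

namespace P4aux
open Trigraph

theorem single_adj {V : Type*} (u v a b : V) :
    (single u v).Adj a b ↔ ((a = u ∧ b = v) ∨ (a = v ∧ b = u)) ∧ a ≠ b := by
  simp [single, SimpleGraph.fromEdgeSet_adj]

/-- a four-vertex path as a subgraph -/
def Sub4 {V : Type*} (G : SimpleGraph V) (a b c d : V) : Prop :=
  a ≠ c ∧ a ≠ d ∧ b ≠ d ∧ G.Adj a b ∧ G.Adj b c ∧ G.Adj c d

theorem hasSubCopy_iff {V : Type*} (G : SimpleGraph V) :
    HasSubCopy (pathGraph 4) G ↔ ∃ a b c d, Sub4 G a b c d := by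
  constructor
  · rintro ⟨f, hf, h⟩
    refine ⟨f 0, f 1, f 2, f 3, ?_, ?_, ?_, ?_, ?_, ?_⟩
    · exact fun e => absurd (hf e) (by decide)
    · exact fun e => absurd (hf e) (by decide)
    · exact fun e => absurd (hf e) (by decide)
    · exact h _ _ (by simp [pathGraph_adj])
    · exact h _ _ (by simp [pathGraph_adj])
    · exact h _ _ (by simp [pathGraph_adj])
  · rintro ⟨a, b, c, d, h1, h2, h3, h4, h5, h6⟩
    have h7 := h4.ne
    have h8 := h5.ne
    have h9 := h6.ne
    refine ⟨![a, b, c, d], ?_, ?_⟩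
    · intro i j hij
      fin_cases i <;> fin_cases j <;> simp_all
    · intro i j hij
      rw [pathGraph_adj] at hij
      fin_cases i <;> fin_cases j <;> simp_all [G.adj_comm]

theorem isSat_iff {V : Type*} (G : SimpleGraph V) :
    IsSat (pathGraph 4) G ↔ (∀ a b c d, ¬ Sub4 G a b c d) ∧
      ∀ u v, u ≠ v → ¬ G.Adj u v → ∃ a b c d, Sub4 (G ⊔ single u v) a b c d := by
  simp only [IsSat, hasSubCopy_iff, not_exists]

/-- the extremal graph: disjoint cliques of size two, the last one possibly a triangle -/
def ext (n : ℕ) : SimpleGraph (Fin n) where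
  Adj u v := u ≠ v ∧ min (u.val / 2) (n / 2 - 1) = min (v.val / 2) (n / 2 - 1)
  symm := ⟨fun _ _ h => ⟨h.1.symm, h.2.symm⟩⟩
  loopless := ⟨fun _ h => h.1 rfl⟩

theorem ext_partner (n : ℕ) (hn : 2 ≤ n) (u : Fin n) : ∃ v, (ext n).Adj v u := by
  obtain ⟨u, hu⟩ := u
  by_cases h : u % 2 = 0 ∧ u + 1 < n
  · refine ⟨⟨u + 1, h.2⟩, ?_, ?_⟩
    · simp
    · show min ((u+1) / 2) (n / 2 - 1) = min (u / 2) (n / 2 - 1)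
      omega
  · refine ⟨⟨u - 1, by omega⟩, ?_, ?_⟩
    · simp only [ne_eq, Fin.mk.injEq]; omega
    · show min ((u-1) / 2) (n / 2 - 1) = min (u / 2) (n / 2 - 1)
      omega

theorem ext_sat (n : ℕ) (hn : 2 ≤ n) : IsSat (pathGraph 4) (ext n) := by
  rw [isSat_iff]
  constructor
  · rintro a b c d ⟨h1, h2, h3, ⟨h4, h4'⟩, ⟨h5, h5'⟩, ⟨h6, h6'⟩⟩
    simp only [ne_eq, Fin.ext_iff] at *
    omega
  · intro u v huv hn'
    obtain ⟨u', hu⟩ := ext_partner n hn u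
    obtain ⟨v', hv⟩ := ext_partner n hn v
    have huv' : min (u.val / 2) (n / 2 - 1) ≠ min (v.val / 2) (n / 2 - 1) := fun h => hn' ⟨huv, h⟩
    refine ⟨u', u, v, v', ?_, ?_, ?_, Or.inl hu, Or.inr ?_, Or.inl hv.symm⟩
    · rintro rfl; exact huv' hu.2.symm
    · rintro rfl; exact huv' (hu.2.symm.trans hv.2)
    · rintro rfl; exact huv' hv.2
    · rw [single_adj]; simp [huv]

theorem ext_card (n m : ℕ) (hn : 5 ≤ n) (hm : (n = 2 * m) ∨ (n + 3 = 2 * m)) :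
    (ext n).edgeSet.ncard ≤ m := by
  have : NeZero n := ⟨by omega⟩
  let g : ℕ → Sym2 (Fin n) := fun j =>
    if 2 * j + 1 < n then s(Fin.ofNat n (2 * j), Fin.ofNat n (2 * j + 1))
    else if 2 * j + 1 = n then s(Fin.ofNat n (n - 2), Fin.ofNat n (n - 1))
    else s(Fin.ofNat n (n - 3), Fin.ofNat n (n - 1))
  have hsub : (ext n).edgeSet ⊆ g '' (Finset.range m : Set ℕ) := by
    intro e
    induction e using Sym2.ind with
    | _ u v =>
    intro h
    rw [SimpleGraph.mem_edgeSet] at h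
    wlog huv : u < v generalizing u v with H
    · rw [Sym2.eq_swap]
      exact H v u h.symm (lt_of_le_of_ne (not_lt.mp huv) h.1.symm)
    obtain ⟨h1, h2⟩ := h
    obtain ⟨u, hu⟩ := u
    obtain ⟨v, hv⟩ := v
    simp only [Fin.mk_lt_mk] at huv
    simp only at h2
    have key : ∀ (x : ℕ) (hx : x < n) (y : ℕ), y = x → Fin.ofNat n y = ⟨x, hx⟩ := by
      rintro x hx y rfl
      ext
      simp [Nat.mod_eq_of_lt hx]
    by_cases c1 : v = u + 1 ∧ u % 2 = 0
    · refine ⟨u / 2, by simp; omega, ?_⟩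
      simp only [g]
      rw [if_pos (by omega), key u hu _ (by omega), key v hv _ (by omega)]
    · by_cases c2 : v = u + 1
      · refine ⟨n / 2, by simp; omega, ?_⟩
        simp only [g]
        rw [if_neg (by omega), if_pos (by omega), key u hu _ (by omega), key v hv _ (by omega)]
      · refine ⟨n / 2 + 1, by simp; omega, ?_⟩
        simp only [g]
        rw [if_neg (by omega), if_neg (by omega), key u hu _ (by omega), key v hv _ (by omega)]
  calc _ ≤ (g '' (Finset.range m : Set ℕ)).ncard := Set.ncard_le_ncard hsub (Set.toFinite _)
    _ ≤ (Finset.range m : Set ℕ).ncard := Set.ncard_image_le (Set.toFinite _)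
    _ = m := by rw [Set.ncard_coe_finset]; simp

theorem sat_lower (n m : ℕ) (hn : n = 5 ∨ 7 ≤ n) (hm : (n = 2 * m) ∨ (n + 3 = 2 * m))
    (G : SimpleGraph (Fin n)) (hG : IsSat (pathGraph 4) G) : m ≤ G.edgeSet.ncard := by
  classical
  rw [isSat_iff] at hG
  obtain ⟨hfree, hsat⟩ := hG
  have hE : G.edgeSet.ncard = G.edgeFinset.card := by
    rw [← Set.ncard_coe_finset, SimpleGraph.coe_edgeFinset]
  rw [hE]
  have hs := G.sum_degrees_eq_twice_card_edges
  have hsum : ∀ (s : Finset (Fin n)), ∑ v ∈ s, 1 = s.card := by simp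
  by_cases hiso : ∃ w, ∀ v, ¬ G.Adj w v
  · obtain ⟨w, hw⟩ := hiso
    have hpath : ∀ v, v ≠ w → ∃ x y, G.Adj v x ∧ G.Adj x y ∧ y ≠ v := by
      intro v hv
      obtain ⟨a, b, c, d, h⟩ := hsat w v hv.symm (hw v)
      have hf := hfree a b c d
      have hw' : ∀ v, ¬ G.Adj v w := fun v h => hw v h.symm
      simp only [Sub4, SimpleGraph.sup_adj, single_adj] at h hf
      have := G.symm
      by_cases haw : a = w
      · refine ⟨c, d, ?_⟩
        grind
      · refine ⟨b, a, ?_⟩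
        have := G.adj_comm
        grind
    have hdeg : ∀ v, v ≠ w → 2 ≤ G.degree v := by
      intro v hv
      obtain ⟨c, d, h1, h2, h3⟩ := hpath v hv
      have hc : c ≠ w := by rintro rfl; exact hw _ h1.symm
      obtain ⟨x, y, h4, h5, h6⟩ := hpath c hc
      by_contra hlt
      have hle : G.degree v ≤ 1 := by omega
      rw [← SimpleGraph.card_neighborFinset_eq_degree, Finset.card_le_one] at hle
      have huni : ∀ z, G.Adj v z → z = c := fun z hz =>
        hle z (by simpa using hz) c (by simpa using h1)
      by_cases hxv : x = v
      · subst hxv; exact h6 (huni y h5)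
      · refine hfree v c x y ⟨Ne.symm hxv, ?_, h6.symm, h1, h4, h5⟩
        rintro rfl
        exact h4.ne (huni x h5.symm).symm
    have : ∑ v ∈ Finset.univ.erase w, 2 ≤ ∑ v ∈ Finset.univ.erase w, G.degree v :=
      Finset.sum_le_sum (fun v hv => hdeg v (Finset.ne_of_mem_erase hv))
    have h2 : ∑ v ∈ Finset.univ.erase w, G.degree v ≤ ∑ v, G.degree v :=
      Finset.sum_le_sum_of_subset (Finset.erase_subset _ _)
    simp only [Finset.sum_const, Finset.card_erase_of_mem (Finset.mem_univ w),
      Finset.card_univ, Fintype.card_fin, smul_eq_mul] at this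
    omega
  · push Not at hiso
    have hdeg : ∀ v, 1 ≤ G.degree v := by
      intro v
      rw [Nat.succ_le_iff, SimpleGraph.degree_pos_iff_exists_adj]
      exact hiso v
    have hge : ∀ f : Fin n → ℕ, (∀ v, f v ≤ G.degree v) → ∑ v, f v ≤ 2 * G.edgeFinset.card := by
      intro f hf
      rw [← hs]
      exact Finset.sum_le_sum (fun v _ => hf v)
    have h0 := hge (fun _ => 1) hdeg
    simp only [Finset.sum_const, Finset.card_univ, Fintype.card_fin, smul_eq_mul, mul_one] at h0
    rcases hm with hm | hm
    · omega
    by_contra hlt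
    have hex : ∃ c, 2 ≤ G.degree c := by
      by_contra hno
      push Not at hno
      have : ∑ v, G.degree v = ∑ v : Fin n, 1 :=
        Finset.sum_congr rfl (fun v _ => by have := hno v; have := hdeg v; omega)
      simp at this
      omega
    obtain ⟨c, hc⟩ := hex
    have hc3 : G.degree c ≤ 2 := by
      by_contra h
      have := hge (fun v => 1 + if v = c then 2 else 0) (fun v => by
        have := hdeg v
        by_cases hv : v = c
        · subst hv; simp; omega
        · simp [hv]; omega)
      simp [Finset.sum_add_distrib] at this hlt
      omega
    have hother : ∀ x, x ≠ c → G.degree x ≤ 1 := by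
      intro x hx
      by_contra h
      have := hge (fun v => 1 + ((if v = c then 1 else 0) + if v = x then 1 else 0)) (fun v => by
        have := hdeg v
        by_cases hv : v = c
        · subst hv; simp [Ne.symm hx]; omega
        · by_cases hv' : v = x
          · subst hv'; simp [hv]; omega
          · simp [hv, hv']; omega)
      simp [Finset.sum_add_distrib] at this hlt
      omega
    have hc2 : G.degree c = 2 := le_antisymm hc3 hc
    rw [← SimpleGraph.card_neighborFinset_eq_degree, Finset.card_eq_two] at hc2
    obtain ⟨a, b, hab, hN⟩ := hc2
    have hcN : ∀ z, G.Adj c z ↔ z = a ∨ z = b := by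
      intro z
      rw [← SimpleGraph.mem_neighborFinset, hN]; simp
    have huni : ∀ x, x ≠ c → ∀ y z, G.Adj x y → G.Adj x z → y = z := by
      intro x hx y z hy hz
      have := hother x hx
      rw [← SimpleGraph.card_neighborFinset_eq_degree, Finset.card_le_one] at this
      exact this y (by simpa using hy) z (by simpa using hz)
    have hca : G.Adj c a := (hcN a).2 (Or.inl rfl)
    have hcb : G.Adj c b := (hcN b).2 (Or.inr rfl)
    have haN : ∀ z, G.Adj a z → z = c := fun z hz => huni a hca.ne.symm z c hz hca.symm
    have hbN : ∀ z, G.Adj b z → z = c := fun z hz => huni b hcb.ne.symm z c hz hcb.symm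
    have hnab : ¬ G.Adj a b := fun h => hcb.ne (haN b h).symm
    obtain ⟨p, q, r, s, h⟩ := hsat a b hab hnab
    have hf := hfree p q r s
    have hclosed : ∀ x y, (G ⊔ single a b).Adj x y → (x = a ∨ x = b ∨ x = c) →
        (y = a ∨ y = b ∨ y = c) := by
      intro x y hxy hx
      rw [SimpleGraph.sup_adj, single_adj] at hxy
      rcases hxy with hxy | hxy
      · rcases hx with rfl | rfl | rfl
        · exact Or.inr (Or.inr (haN _ hxy))
        · exact Or.inr (Or.inr (hbN _ hxy))
        · rcases (hcN y).1 hxy with h | h <;> simp [h]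
      · rcases hxy.1 with h | h <;> simp [h.2]
    obtain ⟨n1, n2, n3, e1, e2, e3⟩ := h
    have n4 := e1.ne
    have n5 := e2.ne
    have n6 := e3.ne
    have k1 := hclosed _ _ e1
    have k2 := hclosed _ _ e2
    have k3 := hclosed _ _ e3
    have k1' := hclosed _ _ e1.symm
    have k2' := hclosed _ _ e2.symm
    have k3' := hclosed _ _ e3.symm
    simp only [Sub4] at hf
    rw [SimpleGraph.sup_adj, single_adj] at e1 e2 e3
    grind

theorem satNum_eq (n m : ℕ) (hn : n = 5 ∨ 7 ≤ n) (hm : (n = 2 * m) ∨ (n + 3 = 2 * m)) :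
    satNum n (pathGraph 4) = (m : ℕ∞) := by
  apply le_antisymm
  · refine le_trans (sInf_le ⟨ext n, ext_sat n (by omega), rfl⟩) ?_
    exact_mod_cast ext_card n m (by omega) hm
  · refine le_sInf ?_
    rintro k ⟨G, hG, rfl⟩
    exact_mod_cast sat_lower n m hn hm G hG

/-- an induced four-vertex path in some realization -/
def Ind4 {V : Type*} (T : Trigraph V) (a b c d : V) : Prop :=
  a ≠ c ∧ a ≠ d ∧ b ≠ d ∧ (T.black.Adj a b ∨ T.gray.Adj a b) ∧
    (T.black.Adj b c ∨ T.gray.Adj b c) ∧ (T.black.Adj c d ∨ T.gray.Adj c d) ∧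
    ¬ T.black.Adj a c ∧ ¬ T.black.Adj a d ∧ ¬ T.black.Adj b d

theorem exists_iff {V : Type*} (T : Trigraph V) :
    (∃ R, T.IsRealization R ∧ HasInducedCopy (pathGraph 4) R) ↔ ∃ a b c d, Ind4 T a b c d := by
  constructor
  · rintro ⟨R, ⟨h1, h2⟩, ⟨f⟩⟩
    have hne : ∀ i j, i ≠ j → f i ≠ f j := fun i j h e => h (f.injective e)
    have had : ∀ i j, (pathGraph 4).Adj i j → T.black.Adj (f i) (f j) ∨ T.gray.Adj (f i) (f j) :=
      fun i j h => by simpa using h2 (f.map_rel_iff.2 h)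
    have hna : ∀ i j, ¬ (pathGraph 4).Adj i j → ¬ T.black.Adj (f i) (f j) :=
      fun i j h e => h (f.map_rel_iff.1 (h1 e))
    refine ⟨f 0, f 1, f 2, f 3, hne _ _ (by decide), hne _ _ (by decide), hne _ _ (by decide),
      had _ _ ?_, had _ _ ?_, had _ _ ?_, hna _ _ ?_, hna _ _ ?_, hna _ _ ?_⟩ <;>
    simp [pathGraph_adj]
  · rintro ⟨a, b, c, d, h1, h2, h3, h4, h5, h6, h7, h8, h9⟩
    have n1 : a ≠ b := fun e => by subst e; simp at h4
    have n2 : b ≠ c := fun e => by subst e; simp at h5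
    have n3 : c ≠ d := fun e => by subst e; simp at h6
    refine ⟨(T.black ⊔ T.gray) \ (single a c ⊔ single a d ⊔ single b d), ⟨?_, ?_⟩, ?_⟩
    · intro x y hxy
      simp only [SimpleGraph.sdiff_adj, SimpleGraph.sup_adj, single_adj]
      refine ⟨Or.inl hxy, ?_⟩
      have := hxy.symm
      grind
    · exact sdiff_le
    · refine ⟨⟨⟨![a, b, c, d], ?_⟩, ?_⟩⟩
      · intro i j hij
        fin_cases i <;> fin_cases j <;> simp_all
      · intro i j
        have s1 := T.black.adj_comm
        have s2 := T.gray.adj_comm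
        rw [pathGraph_adj]
        change ((T.black ⊔ T.gray) \ (single a c ⊔ single a d ⊔ single b d)).Adj
          (![a, b, c, d] i) (![a, b, c, d] j) ↔ _
        simp only [SimpleGraph.sdiff_adj, SimpleGraph.sup_adj,
          single_adj]
        fin_cases i <;> fin_cases j <;> simp <;> grind

theorem isIndSat_iff {V : Type*} (T : Trigraph V) :
    IsIndSat (pathGraph 4) T ↔ (∀ a b c d, ¬ Ind4 T a b c d) ∧
      ∀ u v, u ≠ v → ¬ T.gray.Adj u v → ∃ a b c d, Ind4 (T.flip u v) a b c d := by
  unfold IsIndSat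
  simp only [exists_iff]
  have := exists_iff T
  constructor
  · rintro ⟨h1, h2⟩
    refine ⟨fun a b c d h => ?_, h2⟩
    obtain ⟨R, hR, hR'⟩ := this.2 ⟨a, b, c, d, h⟩
    exact h1 R hR hR'
  · rintro ⟨h1, h2⟩
    refine ⟨fun R hR hR' => ?_, h2⟩
    obtain ⟨a, b, c, d, h⟩ := this.1 ⟨R, hR, hR'⟩
    exact h1 a b c d h

/-- saturated, without isolated vertices, at most `m` gray edges -/
structure Good {V : Type*} (T : Trigraph V) (m : ℕ) : Prop where
  free : ∀ a b c d, ¬ Ind4 T a b c d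
  sat : ∀ u v, u ≠ v → ¬ T.gray.Adj u v → ∃ a b c d, Ind4 (T.flip u v) a b c d
  iso : ∀ u, ∃ v, T.black.Adj u v ∨ T.gray.Adj u v
  card : T.gray.edgeSet.ncard ≤ m

theorem ind4_flip {V : Type*} (T : Trigraph V) (u v a b c d : V) :
    Ind4 (T.flip u v) a b c d ↔ a ≠ c ∧ a ≠ d ∧ b ≠ d ∧ a ≠ b ∧ b ≠ c ∧ c ≠ d ∧
      (T.black.Adj a b ∨ T.gray.Adj a b ∨ (a = u ∧ b = v) ∨ (a = v ∧ b = u)) ∧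
      (T.black.Adj b c ∨ T.gray.Adj b c ∨ (b = u ∧ c = v) ∨ (b = v ∧ c = u)) ∧
      (T.black.Adj c d ∨ T.gray.Adj c d ∨ (c = u ∧ d = v) ∨ (c = v ∧ d = u)) ∧
      (T.black.Adj a c → (a = u ∧ c = v) ∨ (a = v ∧ c = u)) ∧
      (T.black.Adj a d → (a = u ∧ d = v) ∨ (a = v ∧ d = u)) ∧
      (T.black.Adj b d → (b = u ∧ d = v) ∨ (b = v ∧ d = u)) := by
  have k1 := fun x y (h : T.black.Adj x y) => h.ne
  have k2 := fun x y (h : T.gray.Adj x y) => h.ne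
  simp only [Ind4, Trigraph.flip, SimpleGraph.sdiff_adj, SimpleGraph.sup_adj, single_adj]
  grind

theorem flip_comm {V : Type*} (T : Trigraph V) (u v : V) : T.flip u v = T.flip v u := by
  unfold Trigraph.flip Trigraph.single
  simp only [Sym2.eq_swap]

/-- relabelling -/
def relabel {V W : Type*} (e : W ≃ V) (T : Trigraph V) : Trigraph W where
  black := T.black.comap e
  gray := T.gray.comap e
  disjoint := fun u v h => T.disjoint (e u) (e v) h

theorem good_relabel {V W : Type*} [Finite V] (e : W ≃ V) (T : Trigraph V) (m : ℕ) (h : Good T m) :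
    Good (relabel e T) m where
  free a b c d h' := by
    apply h.free (e a) (e b) (e c) (e d)
    simpa [Ind4, relabel] using h'
  sat u v huv hg := by
    obtain ⟨a, b, c, d, h'⟩ := h.sat (e u) (e v) (by simpa using huv) hg
    refine ⟨e.symm a, e.symm b, e.symm c, e.symm d, ?_⟩
    rw [ind4_flip] at h' ⊢
    simpa [relabel, Equiv.symm_apply_eq] using h'
  iso u := by
    obtain ⟨v, hv⟩ := h.iso (e u)
    exact ⟨e.symm v, by simpa [relabel] using hv⟩
  card := by
    refine le_trans ?_ h.card
    have : (relabel e T).gray.edgeSet ⊆ Sym2.map e.symm '' T.gray.edgeSet := by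
      intro x
      induction x using Sym2.ind with
      | _ x y =>
      intro hxy
      exact ⟨s(e x, e y), hxy, by simp⟩
    exact (Set.ncard_le_ncard this (Set.toFinite _)).trans (Set.ncard_image_le (Set.toFinite _))

/-- disjoint union with a gray edge -/
def addEdge {V : Type*} (T : Trigraph V) : Trigraph (V ⊕ Bool) where
  black := T.black ⊕g ⊥
  gray := T.gray ⊕g ⊤
  disjoint := by
    rintro (u | u) (v | v) <;> simp
    exact fun h h' => T.disjoint u v ⟨h, h'⟩

theorem good_addEdge {V : Type*} [Finite V] (T : Trigraph V) (m : ℕ) (h : Good T m) :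
    Good (addEdge T) (m + 1) where
  free := by
    rintro (a | a) (b | b) (c | c) (d | d) <;> simp [Ind4, addEdge]
    · have := h.free a b c d
      simp only [Ind4] at this
      tauto
    · intros
      cases a <;> cases b <;> cases c <;> simp_all
  sat := by
    have key : ∀ (u : V) (v : Bool), ∃ a b c d, Ind4 ((addEdge T).flip (.inl u) (.inr v)) a b c d := by
      intro u v
      obtain ⟨u', hu'⟩ := h.iso u
      refine ⟨.inl u', .inl u, .inr v, .inr (!v), ?_⟩
      rw [ind4_flip]
      have h1 : u ≠ u' := fun e => by subst e; simp at hu'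
      have h2 := T.black.adj_comm u u'
      have h3 := T.gray.adj_comm u u'
      simp [addEdge, h1.symm]
      tauto
    rintro (u | u) (v | v) huv hg
    · obtain ⟨a, b, c, d, h'⟩ := h.sat u v (by simpa using huv) (by simpa [addEdge] using hg)
      refine ⟨.inl a, .inl b, .inl c, .inl d, ?_⟩
      rw [ind4_flip] at h' ⊢
      simpa [addEdge] using h'
    · exact key u v
    · rw [flip_comm]; exact key v u
    · simp [addEdge] at hg huv
      exact absurd hg huv
  iso := by
    rintro (u | u)
    · obtain ⟨v, hv⟩ := h.iso u
      exact ⟨.inl v, by simpa [addEdge] using hv⟩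
    · exact ⟨.inr (!u), by simp [addEdge]⟩
  card := by
    have : (addEdge T).gray.edgeSet ⊆
        (Sym2.map Sum.inl '' T.gray.edgeSet) ∪ {s(.inr false, .inr true)} := by
      intro x
      induction x using Sym2.ind with
      | _ x y =>
      intro hxy
      rw [SimpleGraph.mem_edgeSet] at hxy
      rcases x with x | x <;> rcases y with y | y <;> simp [addEdge] at hxy
      · exact Or.inl ⟨s(x, y), hxy, by simp⟩
      · right
        cases x <;> cases y <;> simp at hxy ⊢
    refine (Set.ncard_le_ncard this (Set.toFinite _)).trans ((Set.ncard_union_le _ _).trans ?_)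
    rw [Set.ncard_singleton]
    exact Nat.add_le_add_right ((Set.ncard_image_le (Set.toFinite _)).trans h.card) 1

/-- add a vertex joined by black edges to everything -/
def addDom {V : Type*} (T : Trigraph V) : Trigraph (Option V) where
  black :=
    { Adj := fun x y => match x, y with
        | none, none => False
        | none, some _ => True
        | some _, none => True
        | some a, some b => T.black.Adj a b
      symm := ⟨by
        rintro (_ | x) (_ | y) h
        · exact h
        · trivial
        · trivial
        · exact T.black.symm.1 _ _ h⟩
      loopless := ⟨by
        rintro (_ | x) h
        · exact h
        · exact T.black.loopless.1 _ h⟩ }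
  gray :=
    { Adj := fun x y => match x, y with
        | none, _ => False
        | some _, none => False
        | some a, some b => T.gray.Adj a b
      symm := ⟨by
        rintro (_ | x) (_ | y) h
        · exact h
        · exact h
        · exact h
        · exact T.gray.symm.1 _ _ h⟩
      loopless := ⟨by
        rintro (_ | x) h
        · exact h
        · exact T.gray.loopless.1 _ h⟩ }
  disjoint := by
    rintro (_ | u) (_ | v) ⟨h, h'⟩
    · exact h'
    · exact h'
    · exact h'
    · exact T.disjoint u v ⟨h, h'⟩

theorem good_addDom {V : Type*} [Finite V] [Nonempty V] (T : Trigraph V) (m : ℕ) (h : Good T m)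
    (hq : ∀ t, ∃ t' x, (T.black.Adj t t' ∨ T.gray.Adj t t') ∧ x ≠ t ∧ x ≠ t' ∧
      ¬ T.black.Adj t x ∧ ¬ T.black.Adj t' x) :
    Good (addDom T) m where
  free := by
    rintro (_ | a) (_ | b) (_ | c) (_ | d) <;> simp [Ind4, addDom]
    have := h.free a b c d
    simp only [Ind4] at this
    tauto
  sat := by
    have key : ∀ (u : V), ∃ a b c d, Ind4 ((addDom T).flip (some u) none) a b c d := by
      intro u
      obtain ⟨t', x, h1, h2, h3, h4, h5⟩ := hq u
      refine ⟨some u, some t', none, some x, ?_⟩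
      rw [ind4_flip]
      have h1 : u ≠ t' := fun e => by subst e; simp at h1
      simp [addDom, h1, h2.symm, h3.symm, h4, h5]
      tauto
    rintro (_ | u) (_ | v) huv hg
    · exact absurd rfl huv
    · rw [flip_comm]; exact key v
    · exact key u
    · obtain ⟨a, b, c, d, h'⟩ := h.sat u v (by simpa using huv) (by simpa [addDom] using hg)
      refine ⟨some a, some b, some c, some d, ?_⟩
      rw [ind4_flip] at h' ⊢
      simpa [addDom] using h'
  iso := by
    rintro (_ | u)
    · exact ⟨some (Classical.arbitrary V), by simp [addDom]⟩
    · exact ⟨none, by simp [addDom]⟩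
  card := by
    refine le_trans ?_ h.card
    have : (addDom T).gray.edgeSet ⊆ Sym2.map some '' T.gray.edgeSet := by
      intro x
      induction x using Sym2.ind with
      | _ x y =>
      intro hxy
      rw [SimpleGraph.mem_edgeSet] at hxy
      rcases x with _ | x <;> rcases y with _ | y <;> simp [addDom] at hxy
      exact ⟨s(x, y), hxy, by simp⟩
    exact (Set.ncard_le_ncard this (Set.toFinite _)).trans (Set.ncard_image_le (Set.toFinite _))

theorem good_addEdge_q {V : Type*} [Nonempty V] (T : Trigraph V) (m : ℕ) (h : Good T m)
    (t : V ⊕ Bool) : ∃ t' x, ((addEdge T).black.Adj t t' ∨ (addEdge T).gray.Adj t t') ∧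
      x ≠ t ∧ x ≠ t' ∧ ¬ (addEdge T).black.Adj t x ∧ ¬ (addEdge T).black.Adj t' x := by
  rcases t with t | t
  · obtain ⟨t', ht⟩ := h.iso t
    exact ⟨.inl t', .inr true, by simpa [addEdge] using ht⟩
  · exact ⟨.inr (!t), .inl (Classical.arbitrary V), by simp [addEdge]⟩

theorem step2 (n m : ℕ) (h : ∃ T : Trigraph (Fin n), Good T m) :
    ∃ T : Trigraph (Fin (n + 2)), Good T (m + 1) := by
  obtain ⟨T, hT⟩ := h
  have e : Fin (n + 2) ≃ Fin n ⊕ Bool := Fintype.equivOfCardEq (by simp)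
  exact ⟨_, good_relabel e _ _ (good_addEdge T m hT)⟩

theorem step3 (n m : ℕ) (hn : 0 < n) (h : ∃ T : Trigraph (Fin n), Good T m) :
    ∃ T : Trigraph (Fin (n + 3)), Good T (m + 1) := by
  obtain ⟨T, hT⟩ := h
  have : Nonempty (Fin n) := ⟨⟨0, hn⟩⟩
  have e : Fin (n + 3) ≃ Option (Fin n ⊕ Bool) := Fintype.equivOfCardEq (by simp)
  exact ⟨_, good_relabel e _ _
    (good_addDom _ _ (good_addEdge T m hT) (good_addEdge_q T m hT))⟩

theorem exists_good (n : ℕ) (hn : n = 2 ∨ 4 ≤ n) :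
    ∃ T : Trigraph (Fin n), Good T ((n + 3) / 3) := by
  have h0 : ∃ T : Trigraph (Fin 0), Good T 0 :=
    ⟨⟨⊥, ⊥, by simp⟩, ⟨fun a => a.elim0, fun a => a.elim0, fun a => a.elim0, by simp⟩⟩
  have h2 := step2 _ _ h0
  have h4 := step2 _ _ h2
  have h6 := step2 _ _ h4
  induction n using Nat.strong_induction_on with
  | _ n ih =>
  by_cases c2 : n = 2
  · subst c2; exact h2
  by_cases c4 : n = 4
  · subst c4; exact h4
  by_cases c6 : n = 6
  · subst c6; exact h6
  obtain ⟨k, rfl⟩ : ∃ k, n = k + 3 := ⟨n - 3, by omega⟩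
  have := step3 k _ (by omega) (ih k (by omega) (by omega))
  rwa [show (k + 3 + 3) / 3 = (k + 3) / 3 + 1 by omega]

theorem indsat_le (n : ℕ) (hn : n = 2 ∨ 4 ≤ n) :
    indsat n (pathGraph 4) ≤ (((n + 3) / 3 : ℕ) : ℕ∞) := by
  obtain ⟨T, hT⟩ := exists_good n hn
  refine le_trans (sInf_le ⟨T, (isIndSat_iff T).2 ⟨hT.free, hT.sat⟩, rfl⟩) ?_
  exact_mod_cast hT.card

end P4aux

/-- For `n = 5` or `n ≥ 7`, `indsat(n, P_4) < sat(n, P_4)`, where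
`sat(n, P_4) = k` if `n = 2k` and `sat(n, P_4) = k + 1` if `n = 2k − 1`; i.e.
`⌈(n+1)/3⌉ < sat(n, P_4)` for these `n`. -/
theorem indsat_lt_satNum_pathGraph_four (n : ℕ) (hn : n = 5 ∨ 7 ≤ n) :
    Trigraph.indsat n (SimpleGraph.pathGraph 4) <
      Trigraph.satNum n (SimpleGraph.pathGraph 4) ∧
    ∀ k : ℕ,
      (n = 2 * k →
        Trigraph.satNum n (SimpleGraph.pathGraph 4) = (k : ℕ∞) ∧ (n + 1 + 2) / 3 < k) ∧
      (n = 2 * k - 1 →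
        Trigraph.satNum n (SimpleGraph.pathGraph 4) = ((k : ℕ∞) + 1) ∧
          (n + 1 + 2) / 3 < k + 1) := by
  constructor
  · obtain ⟨m, hm⟩ : ∃ m, (n = 2 * m) ∨ (n + 3 = 2 * m) := by
      rcases Nat.even_or_odd' n with ⟨j, hj | hj⟩
      · exact ⟨j, Or.inl hj⟩
      · exact ⟨j + 2, Or.inr (by omega)⟩
    rw [P4aux.satNum_eq n m hn hm]
    refine lt_of_le_of_lt (P4aux.indsat_le n (by omega)) ?_
    exact_mod_cast (by omega : (n + 3) / 3 < m)
  · intro k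
    refine ⟨fun h => ⟨P4aux.satNum_eq n k hn (Or.inl h), by omega⟩, fun h => ⟨?_, by omega⟩⟩
    have := P4aux.satNum_eq n (k + 1) hn (Or.inr (by omega))
    rw [this]
    push_cast
    rfl
end
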